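/- Let N ≥ 1, let A and B be N×N normal complex matrices, and let F be a free-energy branch for I_N(·;A,B) on some disc D(0,ε). Then for every integer d with 1 ≤ d ≤ N, the series Σ_{g=0}^∞ C_{g,d}(A,B)/N^{2g} converges absolutely and its sum equals the d-th derivative F^{(d)}(0), where C_{g,d}(A,B) = Σ_{α,β⊢d} (−1)^{d+ℓ(α)+ℓ(β)} H⃗_g(α,β) (N^{−ℓ(α)} p_α(A)) (N^{−ℓ(β)} p_β(B)). -/

import Mathlib

open MeasureTheory Matrix

namespace HCIZ

noncomputable instance (N : ℕ) : MeasurableSpace (Matrix (Fin N) (Fin N) ℂ) := borel _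

instance (N : ℕ) : BorelSpace (Matrix (Fin N) (Fin N) ℂ) := ⟨rfl⟩

/-- The number of cycles of a permutation (fixed points counted as cycles). -/
def cycleCount {d : ℕ} (π : Equiv.Perm (Fin d)) : ℕ := π.partition.parts.card

/-- `π` has cycle type `α` (1-cycles included). -/
def HasCycleType {d : ℕ} (π : Equiv.Perm (Fin d)) (α : d.Partition) : Prop :=
  π.partition.parts = α.parts

/-- The tuple `τ` consists of transpositions `(s_i t_i)`, `s_i < t_i`, with
`t_1 ≤ t_2 ≤ ⋯` (monotone condition). -/
def IsMonotoneTuple {d r : ℕ} (τ : Fin r → Equiv.Perm (Fin d)) : Prop :=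
  (∀ i, (τ i).IsSwap) ∧ Monotone fun i => (τ i).support.max

/-- The subgroup generated by `s` acts transitively on `Fin d`. -/
def GeneratesTransitively {d : ℕ} (s : Set (Equiv.Perm (Fin d))) : Prop :=
  ∀ x y : Fin d, ∃ g ∈ Subgroup.closure s, g x = y

/-- `H⃗^r(α,β)`: the number of monotone transitive factorizations of the identity
into `ρ σ τ_1 ⋯ τ_r` with `ρ` of cycle type `α` and `σ` of cycle type `β`. -/
noncomputable def Hr (d : ℕ) (α β : d.Partition) (r : ℕ) : ℕ :=
  Nat.card {T : Equiv.Perm (Fin d) × Equiv.Perm (Fin d) × (Fin r → Equiv.Perm (Fin d)) //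
    HasCycleType T.1 α ∧ HasCycleType T.2.1 β ∧ IsMonotoneTuple T.2.2 ∧
    T.1 * T.2.1 * (List.ofFn T.2.2).prod = 1 ∧
    GeneratesTransitively ({T.1, T.2.1} ∪ Set.range T.2.2)}

/-- `H̃^r(α,β)`: the same count without the transitivity requirement. -/
noncomputable def Hnt (d : ℕ) (α β : d.Partition) (r : ℕ) : ℕ :=
  Nat.card {T : Equiv.Perm (Fin d) × Equiv.Perm (Fin d) × (Fin r → Equiv.Perm (Fin d)) //
    HasCycleType T.1 α ∧ HasCycleType T.2.1 β ∧ IsMonotoneTuple T.2.2 ∧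
    T.1 * T.2.1 * (List.ofFn T.2.2).prod = 1}

/-- The monotone double Hurwitz number `H⃗_g(α,β) = H⃗^r(α,β)`,
`r = 2g - 2 + ℓ(α) + ℓ(β)`. -/
noncomputable def Hg (d g : ℕ) (α β : d.Partition) : ℕ :=
  Hr d α β (2 * g + α.parts.card + β.parts.card - 2)

/-- `m_r(π)`: monotone (not necessarily transitive) factorizations of `π`
into `r` transpositions. -/
noncomputable def mcount (d r : ℕ) (π : Equiv.Perm (Fin d)) : ℕ :=
  Nat.card {τ : Fin r → Equiv.Perm (Fin d) //
    IsMonotoneTuple τ ∧ (List.ofFn τ).prod = π}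

/-- Power sum `p_α(A) = ∏ Tr(A^{α_i})`. -/
noncomputable def pPoly {N : ℕ} (A : Matrix (Fin N) (Fin N) ℂ) {d : ℕ} (α : d.Partition) : ℂ :=
  (α.parts.map fun k => (A ^ k).trace).prod

/-- `φ_α = ∏ φ_{α_i}`. -/
noncomputable def momProd (Φ : ℕ → ℂ) {d : ℕ} (α : d.Partition) : ℂ :=
  (α.parts.map Φ).prod

/-- `C_{g,d}(A,B) = ∑_{α,β ⊢ d} (-1)^{d+ℓ(α)+ℓ(β)} H⃗_g(α,β)
(N^{-ℓ(α)} p_α(A)) (N^{-ℓ(β)} p_β(B))`. -/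
noncomputable def Cmat {N : ℕ} (g d : ℕ) (A B : Matrix (Fin N) (Fin N) ℂ) : ℂ :=
  ∑ α : d.Partition, ∑ β : d.Partition,
    (-1 : ℂ) ^ (d + α.parts.card + β.parts.card) * (Hg d g α β : ℂ) *
      (((N : ℂ) ^ α.parts.card)⁻¹ * pPoly A α) * (((N : ℂ) ^ β.parts.card)⁻¹ * pPoly B β)

/-- `C_{g,d}(Φ,Ψ) = ∑_{α,β ⊢ d} (-1)^{d+ℓ(α)+ℓ(β)} H⃗_g(α,β) φ_α ψ_β`. -/
noncomputable def Cseq (g d : ℕ) (Φ Ψ : ℕ → ℂ) : ℂ :=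
  ∑ α : d.Partition, ∑ β : d.Partition,
    (-1 : ℂ) ^ (d + α.parts.card + β.parts.card) * (Hg d g α β : ℂ) *
      momProd Φ α * momProd Ψ β

/-- The HCIZ integral `I_N(z;A,B)` with respect to a measure `μ` on `U(N)`. -/
noncomputable def hciz {N : ℕ} (μ : Measure (Matrix.unitaryGroup (Fin N) ℂ))
    (A B : Matrix (Fin N) (Fin N) ℂ) (z : ℂ) : ℂ :=
  ∫ U : Matrix.unitaryGroup (Fin N) ℂ,
    Complex.exp (-(z * (N : ℂ) *
      (A * (U : Matrix (Fin N) (Fin N) ℂ) * B *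
        ((U⁻¹ : Matrix.unitaryGroup (Fin N) ℂ) : Matrix (Fin N) (Fin N) ℂ)).trace)) ∂μ

/-- A free-energy branch for `I_N(·;A,B)` on the disc `D(0,ε)`: a holomorphic
function `F` with `F 0 = 0` and `exp (N² F z) = I_N(z;A,B)` on the disc. -/
def IsFreeEnergyBranch {N : ℕ} (μ : Measure (Matrix.unitaryGroup (Fin N) ℂ))
    (A B : Matrix (Fin N) (Fin N) ℂ) (ε : ℝ) (F : ℂ → ℂ) : Prop :=
  DifferentiableOn ℂ F (Metric.ball 0 ε) ∧ F 0 = 0 ∧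
    ∀ z ∈ Metric.ball (0 : ℂ) ε, Complex.exp ((N : ℂ) ^ 2 * F z) = hciz μ A B z

/-- The L² operator norm of a matrix. -/
noncomputable def opNorm {N : ℕ} (A : Matrix (Fin N) (Fin N) ℂ) : ℝ :=
  ‖Matrix.toEuclideanCLM (𝕜 := ℂ) A‖

/-- The all-ones partition `(1^d)`. -/
def onesPartition (d : ℕ) : d.Partition :=
  ⟨Multiset.replicate d 1, fun {i} hi => by
    rw [Multiset.eq_of_mem_replicate hi]; exact one_pos, by simp⟩

/-- The partition `(2,1^{d-2})` of `d`, for `d ≥ 2`. -/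
def twoOnesPartition (d : ℕ) (hd : 2 ≤ d) : d.Partition :=
  ⟨2 ::ₘ Multiset.replicate (d - 2) 1, fun {i} hi => by
    rcases Multiset.mem_cons.mp hi with h | h
    · omega
    · rw [Multiset.eq_of_mem_replicate h]; exact one_pos, by
    simp [Multiset.sum_cons]; omega⟩

section Factorizations

open Equiv Equiv.Perm

section CycleTrace

variable {U W V : Type*}

/-- Permutations of two complementary pieces, glued to a permutation of the whole. -/
def glue (e : U ⊕ W ≃ V) : Perm U × Perm W →* Perm V :=
  e.permCongrHom.toMonoidHom.comp (sumCongrHom U W)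

@[simp]
theorem glue_inl (e : U ⊕ W ≃ V) (x : Perm U × Perm W) (u : U) :
    glue e x (e (Sum.inl u)) = e (Sum.inl (x.1 u)) := by
  simp [glue, Equiv.permCongrHom]

@[simp]
theorem glue_inr (e : U ⊕ W ≃ V) (x : Perm U × Perm W) (w : W) :
    glue e x (e (Sum.inr w)) = e (Sum.inr (x.2 w)) := by
  simp [glue, Equiv.permCongrHom]

theorem glue_injective (e : U ⊕ W ≃ V) : Function.Injective (glue e) :=
  e.permCongrHom.injective.comp sumCongrHom_injective

theorem sum_equiv_cases (e : U ⊕ W ≃ V) (x : V) :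
    (∃ u, x = e (Sum.inl u)) ∨ ∃ w, x = e (Sum.inr w) := by
  obtain ⟨y, rfl⟩ := e.surjective x
  rcases y with u | w
  · exact Or.inl ⟨u, rfl⟩
  · exact Or.inr ⟨w, rfl⟩

theorem glue_swap_left [DecidableEq U] [DecidableEq V] (e : U ⊕ W ≃ V) (a b : U) :
    glue e (swap a b, 1) = swap (e (Sum.inl a)) (e (Sum.inl b)) := by
  ext x
  rcases sum_equiv_cases e x with ⟨u, rfl⟩ | ⟨w, rfl⟩
  · rw [glue_inl]
    simp only [swap_apply_def, EmbeddingLike.apply_eq_iff_eq, Sum.inl.injEq]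
    split_ifs <;> rfl
  · rw [glue_inr]
    simp [swap_apply_def]

theorem glue_swap_right [DecidableEq W] [DecidableEq V] (e : U ⊕ W ≃ V) (a b : W) :
    glue e (1, swap a b) = swap (e (Sum.inr a)) (e (Sum.inr b)) := by
  ext x
  rcases sum_equiv_cases e x with ⟨u, rfl⟩ | ⟨w, rfl⟩
  · rw [glue_inl]
    simp [swap_apply_def]
  · rw [glue_inr]
    simp only [swap_apply_def, EmbeddingLike.apply_eq_iff_eq, Sum.inr.injEq]
    split_ifs <;> rfl

theorem mem_range_glue [Finite U] [Finite W] (e : U ⊕ W ≃ V) (π : Perm V)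
    (h : ∀ u, ∃ u', π (e (Sum.inl u)) = e (Sum.inl u')) : ∃ x, glue e x = π := by
  have := mem_sumCongrHom_range_of_perm_mapsTo_inl (σ := e.permCongrHom.symm π) (by
    rintro _ ⟨u, rfl⟩
    obtain ⟨u', hu'⟩ := h u
    exact ⟨u', by simp [Equiv.permCongrHom, hu']⟩)
  obtain ⟨x, hx⟩ := this
  refine ⟨x, ?_⟩
  have : e.permCongrHom (sumCongrHom U W x) = π := by
    rw [hx, MulEquiv.apply_symm_apply]
  exact this

theorem cycleType_glue [Fintype U] [DecidableEq U] [Fintype W] [DecidableEq W] [Fintype V]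
    [DecidableEq V] (e : U ⊕ W ≃ V) (g : Perm U) (h : Perm W) :
    (glue e (g, h)).cycleType = g.cycleType + h.cycleType := by
  classical
  have h1 : glue e (g, 1) = g.extendDomain
      (Equiv.ofInjective (fun u => e (Sum.inl u)) (e.injective.comp Sum.inl_injective)) := by
    ext x
    rcases sum_equiv_cases e x with ⟨u, rfl⟩ | ⟨w, rfl⟩
    · rw [glue_inl]
      exact (extendDomain_apply_image g (Equiv.ofInjective (fun u => e (Sum.inl u))
        (e.injective.comp Sum.inl_injective)) u).symm
    · rw [glue_inr, extendDomain_apply_not_subtype]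
      · rfl
      · simp
  have h2 : glue e (1, h) = h.extendDomain
      (Equiv.ofInjective (fun w => e (Sum.inr w)) (e.injective.comp Sum.inr_injective)) := by
    ext x
    rcases sum_equiv_cases e x with ⟨u, rfl⟩ | ⟨w, rfl⟩
    · rw [glue_inl, extendDomain_apply_not_subtype]
      · rfl
      · simp
    · rw [glue_inr]
      exact (extendDomain_apply_image h (Equiv.ofInjective (fun w => e (Sum.inr w))
        (e.injective.comp Sum.inr_injective)) w).symm
  have h3 : glue e (g, h) = glue e (g, 1) * glue e (1, h) := by
    rw [← map_mul]; simp
  have h4 : (glue e (g, 1)).Disjoint (glue e (1, h)) := by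
    intro x
    rcases sum_equiv_cases e x with ⟨u, rfl⟩ | ⟨w, rfl⟩
    · right; simp
    · left; simp
  rw [h3, h4.cycleType_mul, h1, h2, cycleType_extendDomain, cycleType_extendDomain]

theorem parts_glue [Fintype U] [DecidableEq U] [Fintype W] [DecidableEq W] [Fintype V]
    [DecidableEq V] (e : U ⊕ W ≃ V) (g : Perm U) (h : Perm W) :
    (glue e (g, h)).partition.parts = g.partition.parts + h.partition.parts := by
  have hc := cycleType_glue e g h
  have hV : Fintype.card V = Fintype.card U + Fintype.card W := by
    rw [← Fintype.card_congr e, Fintype.card_sum]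
  have h1 := g.support.card_le_univ
  have h2 := h.support.card_le_univ
  have h3 : (glue e (g, h)).support.card = g.support.card + h.support.card := by
    rw [← sum_cycleType, hc, Multiset.sum_add, sum_cycleType, sum_cycleType]
  rw [parts_partition, parts_partition, parts_partition, hc, h3, hV,
    show Fintype.card U + Fintype.card W - (g.support.card + h.support.card) =
      (Fintype.card U - g.support.card) + (Fintype.card W - h.support.card) by omega,
    Multiset.replicate_add]
  abel

/-- The trace of `B ^ ⊗V` composed with the permutation operator of `π`. -/
def cycleTrace {ι R : Type*} [Fintype V] [DecidableEq V] [Fintype ι] [CommSemiring R]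
    (B : Matrix ι ι R) (π : Perm V) : R :=
  ∑ i : V → ι, ∏ t, B (i t) (i (π t))

variable {ι R : Type*} [Fintype ι] [CommSemiring R]

theorem cycleTrace_glue [Fintype U] [DecidableEq U] [Fintype W] [DecidableEq W] [Fintype V]
    [DecidableEq V] (B : Matrix ι ι R) (e : U ⊕ W ≃ V) (x : Perm U × Perm W) :
    cycleTrace B (glue e x) = cycleTrace B x.1 * cycleTrace B x.2 := by
  unfold cycleTrace
  rw [Finset.sum_mul_sum, ← Finset.sum_product', Finset.univ_product_univ]
  refine Fintype.sum_equiv ((Equiv.arrowCongr e.symm (Equiv.refl ι)).trans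
    (Equiv.sumArrowEquivProdArrow U W ι)) _ _ fun i => ?_
  rw [← e.prod_comp, Fintype.prod_sum_type]
  simp [Equiv.sumArrowEquivProdArrow]

theorem sum_path (n : ℕ) (B C : Matrix ι ι R) [DecidableEq ι] :
    ∑ i : Fin (n + 1) → ι, (∏ t : Fin n, B (i t.castSucc) (i t.succ)) * C (i (Fin.last n)) (i 0) =
      (B ^ n * C).trace := by
  induction n generalizing C with
  | zero =>
    rw [pow_zero, one_mul, Matrix.trace]
    refine Fintype.sum_equiv (Equiv.funUnique (Fin 1) ι) _ _ fun i => ?_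
    simp
  | succ n ih =>
    rw [pow_succ, Matrix.mul_assoc, ← ih (B * C)]
    rw [← (Fin.snocEquiv fun _ => ι).sum_comp, Fintype.sum_prod_type, Finset.sum_comm]
    refine Finset.sum_congr rfl fun i _ => ?_
    rw [Matrix.mul_apply, Finset.mul_sum]
    refine Finset.sum_congr rfl fun x _ => ?_
    have h0 : (Fin.snoc i x : Fin (n + 2) → ι) 0 = i 0 := by
      rw [← Fin.castSucc_zero, Fin.snoc_castSucc]
    simp only [Fin.snocEquiv, Equiv.coe_fn_mk, Fin.prod_univ_castSucc, Fin.snoc_castSucc,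
      ← Fin.castSucc_succ, Fin.succ_last, Fin.snoc_last]
    rw [h0, mul_assoc]

theorem cycleTrace_transitive [Fintype V] [DecidableEq V] [DecidableEq ι] (B : Matrix ι ι R)
    (π : Perm V) (hπ : π.IsCycleOn Set.univ) (x : V) :
    cycleTrace B π = (B ^ Fintype.card V).trace := by
  obtain ⟨n, hn⟩ : ∃ n, Fintype.card V = n + 1 :=
    Nat.exists_eq_succ_of_ne_zero (Fintype.card_pos_iff.2 ⟨x⟩).ne'
  have hu : π.IsCycleOn ((Finset.univ : Finset V) : Set V) := by simpa using hπ
  have hinj : Function.Injective fun k : Fin (n + 1) => (π ^ (k : ℕ)) x := by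
    intro a b hab
    have := (hu.pow_apply_eq_pow_apply (Finset.mem_univ x)).1 hab
    rw [Finset.card_univ, hn] at this
    exact Fin.ext (Nat.ModEq.eq_of_lt_of_lt this a.2 b.2)
  let e : Fin (n + 1) ≃ V := Equiv.ofBijective _
    ((Fintype.bijective_iff_injective_and_card _).2 ⟨hinj, by simp [hn]⟩)
  have he : ∀ k, e k = (π ^ (k : ℕ)) x := fun k => rfl
  have hs : ∀ t : Fin n, π (e t.castSucc) = e t.succ := fun t => by
    simp [he, pow_succ']
  have hl : π (e (Fin.last n)) = e 0 := by
    have := hu.pow_card_apply (Finset.mem_univ x)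
    rw [Finset.card_univ, hn, pow_succ'] at this
    simpa [he] using this
  rw [hn, pow_succ, ← sum_path]
  refine Fintype.sum_equiv (Equiv.arrowCongr e.symm (Equiv.refl ι)) _ _ fun i => ?_
  rw [← e.prod_comp, Fin.prod_univ_castSucc]
  simp [hs, hl]

theorem parts_transitive [Fintype V] [DecidableEq V]
    (π : Perm V) (hπ : π.IsCycleOn Set.univ) (x : V) :
    π.partition.parts = {Fintype.card V} := by
  rcases subsingleton_or_nontrivial V with hV | hV
  · have : Fintype.card V = 1 := Fintype.card_eq_one_iff.2 ⟨x, fun y => Subsingleton.elim _ _⟩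
    have h1 : π = 1 := Subsingleton.elim _ _
    rw [parts_partition, h1, this]
    simp
  · have hne : ∀ y, π y ≠ y := fun y => hπ.apply_ne Set.nontrivial_univ (Set.mem_univ y)
    have hc : π.IsCycle := ⟨x, hne x, fun y _ => hπ.2 (Set.mem_univ x) (Set.mem_univ y)⟩
    have hs : π.support = Finset.univ := by ext y; simp [hne y]
    rw [parts_partition, hc.cycleType, hs]
    simp

/-- The trace of `B ^ ⊗V` against a permutation is the power sum of its cycle type. -/
theorem cycleTrace_eq [DecidableEq ι] (B : Matrix ι ι R) : ∀ (n : ℕ) (V : Type) [Fintype V]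
    [DecidableEq V] (π : Perm V), Fintype.card V = n →
    cycleTrace B π = (π.partition.parts.map fun k => (B ^ k).trace).prod := by
  intro n
  induction n using Nat.strong_induction_on with
  | _ n ih =>
  intro V _ _ π hV
  rcases isEmpty_or_nonempty V with hE | ⟨⟨x⟩⟩
  · have h1 : π = 1 := Subsingleton.elim _ _
    have : Fintype.card V = 0 := Fintype.card_eq_zero
    rw [parts_partition, h1, this]
    simp [cycleTrace]
  by_cases ht : π.IsCycleOn Set.univ
  · rw [cycleTrace_transitive B π ht x, parts_transitive π ht x]
    simp
  classical
  let p : V → Prop := fun y => π.SameCycle x y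
  have hq : ∃ y, ¬ p y := by
    by_contra! hall
    exact ht ⟨by simp, fun a _ b _ => ((hall a).symm.trans (hall b))⟩
  let e := Equiv.sumCompl p
  obtain ⟨g, hg⟩ := mem_range_glue e π (fun u => ⟨⟨π u, u.2.apply_right⟩, rfl⟩)
  have h1 : Fintype.card {y // p y} < n := by
    obtain ⟨y, hy⟩ := hq
    exact hV ▸ Fintype.card_subtype_lt hy
  have h2 : Fintype.card {y // ¬ p y} < n :=
    hV ▸ Fintype.card_subtype_lt (x := x) (by simp [p, SameCycle.refl])
  rw [← hg, cycleTrace_glue, ih _ h1 _ g.1 rfl, ih _ h2 _ g.2 rfl, parts_glue, Multiset.map_add,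
    Multiset.prod_add]

theorem cycleTrace_eq_pPoly {N d : ℕ} (A : Matrix (Fin N) (Fin N) ℂ) (π : Perm (Fin d))
    (α : d.Partition) (h : HasCycleType π α) : cycleTrace A π = pPoly A α := by
  rw [cycleTrace_eq A _ _ π rfl, h, pPoly]

theorem cycleTrace_one [DecidableEq ι] {d : ℕ} (π : Perm (Fin d)) :
    cycleTrace (1 : Matrix ι ι R) π = (Fintype.card ι : R) ^ cycleCount π := by
  rw [cycleTrace_eq _ _ _ π rfl]
  simp [cycleCount]

end CycleTrace

section CycleCount

variable {d : ℕ}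

/-- Colourings with two colours that are invariant under every permutation in `S`. -/
def invColorings (S : Set (Perm (Fin d))) : Submodule (ZMod 2) (Fin d → ZMod 2) where
  carrier := {c | ∀ g ∈ S, ∀ x, c (g x) = c x}
  add_mem' h h' g hg x := by simp [h g hg x, h' g hg x]
  zero_mem' _ _ _ := rfl
  smul_mem' r c h g hg x := by simp [h g hg x]

theorem mem_invColorings {S : Set (Perm (Fin d))} {c : Fin d → ZMod 2} :
    c ∈ invColorings S ↔ ∀ g ∈ S, ∀ x, c (g x) = c x := Iff.rfl

theorem finrank_invColorings_singleton (π : Perm (Fin d)) :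
    Module.finrank (ZMod 2) (invColorings {π}) = cycleCount π := by
  classical
  have h1 := cycleTrace_one (ι := ZMod 2) (R := ℕ) π
  have h2 : cycleTrace (1 : Matrix (ZMod 2) (ZMod 2) ℕ) π = Fintype.card (invColorings {π}) := by
    have : ∀ i : Fin d → ZMod 2, ∏ t, (1 : Matrix (ZMod 2) (ZMod 2) ℕ) (i t) (i (π t)) =
        if i ∈ invColorings {π} then 1 else 0 := by
      intro i
      simp only [Matrix.one_apply, Finset.prod_boole, Finset.mem_univ, true_imp_iff,
        mem_invColorings, Set.mem_singleton_iff, forall_eq]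
      exact if_congr (forall_congr' fun t => eq_comm) rfl rfl
    rw [cycleTrace, Finset.sum_congr rfl fun i _ => this i, Finset.sum_boole, Fintype.card_subtype]
    simp
  rw [h1, Module.card_eq_pow_finrank (K := ZMod 2) (V := invColorings {π}), ZMod.card] at h2
  exact (Nat.pow_right_injective le_rfl h2).symm

/-- The difference of the colours of `a` and `b`. -/
def colorDiff (a b : Fin d) : (Fin d → ZMod 2) →ₗ[ZMod 2] ZMod 2 :=
  LinearMap.proj (R := ZMod 2) (φ := fun _ => ZMod 2) a -
    LinearMap.proj (R := ZMod 2) (φ := fun _ => ZMod 2) b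

/-- Colourings giving `a` and `b` the same colour. -/
def agree (a b : Fin d) : Submodule (ZMod 2) (Fin d → ZMod 2) :=
  LinearMap.ker (colorDiff a b)

theorem mem_agree {a b : Fin d} {c : Fin d → ZMod 2} : c ∈ agree a b ↔ c a = c b := by
  simp [agree, colorDiff, sub_eq_zero]

theorem finrank_le_inf_agree (F : Submodule (ZMod 2) (Fin d → ZMod 2)) (a b : Fin d) :
    Module.finrank (ZMod 2) F ≤
      Module.finrank (ZMod 2) (F ⊓ agree a b : Submodule (ZMod 2) (Fin d → ZMod 2)) + 1 := by
  let φ := (colorDiff a b).comp F.subtype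
  have h1 := LinearMap.finrank_range_add_finrank_ker φ
  have h2 : Module.finrank (ZMod 2) (LinearMap.range φ) ≤ 1 :=
    (Submodule.finrank_le _).trans (by simp)
  have h3 : (F ⊓ agree a b) = (LinearMap.ker φ).map F.subtype := by
    rw [LinearMap.ker_comp, Submodule.map_comap_subtype]
    rfl
  rw [h3, ← (Submodule.equivSubtypeMap F (LinearMap.ker φ)).finrank_eq, ← h1]
  omega

theorem invColorings_inf_agree_le (π : Perm (Fin d)) (a b : Fin d) :
    invColorings {π} ⊓ agree a b ≤ invColorings {π * swap a b} := by
  rintro c ⟨hc, hab⟩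
  rw [SetLike.mem_coe, mem_agree] at hab
  simp only [SetLike.mem_coe, mem_invColorings, Set.mem_singleton_iff, forall_eq,
    Perm.mul_apply] at hc ⊢
  intro x
  rw [hc, swap_apply_def]
  split_ifs with h1 h2
  · rw [h1, hab]
  · rw [h2, hab]
  · rfl

theorem cycleCount_le_mul_swap (π : Perm (Fin d)) (a b : Fin d) :
    cycleCount π ≤ cycleCount (π * swap a b) + 1 := by
  rw [← finrank_invColorings_singleton, ← finrank_invColorings_singleton]
  have := finrank_le_inf_agree (invColorings {π}) a b
  have := Submodule.finrank_mono (invColorings_inf_agree_le π a b)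
  omega

theorem cycleCount_mul_swap_le (π : Perm (Fin d)) (a b : Fin d) :
    cycleCount (π * swap a b) ≤ cycleCount π + 1 := by
  have := cycleCount_le_mul_swap (π * swap a b) a b
  rwa [mul_assoc, Equiv.swap_mul_self, mul_one] at this

/-- Multiplying by a transposition of points in different cycles joins these cycles. -/
theorem cycleCount_mul_swap_of_separated (π : Perm (Fin d)) (a b : Fin d) (χ : Fin d → ZMod 2)
    (hχ : χ ∈ invColorings {π}) (hab : χ a ≠ χ b) :
    cycleCount (π * swap a b) + 1 = cycleCount π := by
  have hle : invColorings {π * swap a b} ≤ invColorings {π} ⊓ agree a b := by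
    intro c hc
    simp only [mem_invColorings, Set.mem_singleton_iff, forall_eq, Perm.mul_apply] at hc hχ
    have hne : a ≠ b := fun h => hab (by rw [h])
    have hcπ : ∀ x, c (π x) = c (swap a b x) := fun x => by
      have := hc (swap a b x)
      rwa [swap_apply_self] at this
    have h1 : ∑ x, (c (π x) - c x) * χ x = 0 := by
      have : ∑ x, c (π x) * χ x = ∑ x, c x * χ x := by
        rw [← Equiv.sum_comp π fun x => c x * χ x]
        exact Finset.sum_congr rfl fun x _ => by rw [hχ]
      simp_rw [sub_mul]
      rw [Finset.sum_sub_distrib, this, sub_self]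
    have h2 : ∑ x, (c (π x) - c x) * χ x = (c b - c a) * (χ a - χ b) := by
      have h3 : ∀ x ∉ ({a, b} : Finset (Fin d)), (c (π x) - c x) * χ x = 0 := by
        intro x hx
        simp only [Finset.mem_insert, Finset.mem_singleton, not_or] at hx
        rw [hcπ, swap_apply_of_ne_of_ne hx.1 hx.2, sub_self, zero_mul]
      rw [← Finset.sum_subset (Finset.subset_univ {a, b}) fun x _ hx => h3 x hx,
        Finset.sum_pair hne, hcπ, hcπ, swap_apply_left, swap_apply_right]
      ring
    have h4 : c a = c b := by
      rw [h1, eq_comm, mul_eq_zero, sub_eq_zero, sub_eq_zero] at h2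
      exact (h2.resolve_right hab).symm
    refine ⟨?_, mem_agree.2 h4⟩
    simp only [SetLike.mem_coe, mem_invColorings, Set.mem_singleton_iff, forall_eq]
    intro x
    rw [hcπ, swap_apply_def]
    split_ifs with h5 h6
    · rw [h5, h4]
    · rw [h6, h4]
    · rfl
  have h1 : Module.finrank (ZMod 2) (invColorings {π * swap a b}) <
      Module.finrank (ZMod 2) (invColorings {π}) := by
    refine Submodule.finrank_lt_finrank_of_lt (lt_of_le_of_ne (hle.trans inf_le_left) fun h => ?_)
    exact hab (mem_agree.1 (hle (h ▸ hχ)).2)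
  have h2 := cycleCount_le_mul_swap π a b
  rw [finrank_invColorings_singleton, finrank_invColorings_singleton] at h1
  omega

theorem cycleCount_mul_swap_of_fixed (π : Perm (Fin d)) (a b : Fin d) (hne : a ≠ b)
    (h : π b = b) : cycleCount (π * swap a b) + 1 = cycleCount π := by
  refine cycleCount_mul_swap_of_separated π a b (Pi.single b 1) ?_ (by simp [hne])
  simp only [mem_invColorings, Set.mem_singleton_iff, forall_eq]
  intro x
  by_cases hx : x = b
  · rw [hx, h]
  · have : π x ≠ b := fun h' => hx (π.injective (h'.trans h.symm))
    simp [hx, this]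

theorem cycleCount_one : cycleCount (1 : Perm (Fin d)) = d := by
  simp [cycleCount, parts_partition]

theorem cycleCount_le (π : Perm (Fin d)) : cycleCount π ≤ d := by
  rw [← finrank_invColorings_singleton]
  exact (Submodule.finrank_le _).trans (by simp)

/-- Every permutation is a product of `d - cycleCount` transpositions. -/
theorem exists_swap_list : ∀ (n : ℕ) (π : Perm (Fin d)), d - cycleCount π = n →
    ∃ L : List (Perm (Fin d)), (∀ g ∈ L, g.IsSwap) ∧ L.prod = π ∧ L.length + cycleCount π = d := by
  intro n
  induction n using Nat.strong_induction_on with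
  | _ n ih =>
  intro π hn
  by_cases h1 : π = 1
  · exact ⟨[], by simp, by simp [h1], by simp [h1, cycleCount_one]⟩
  obtain ⟨a, ha⟩ : ∃ a, π a ≠ a := by
    by_contra! h
    exact h1 (Equiv.ext h)
  have hx : π⁻¹ a ≠ a := fun h => ha (by rw [Perm.inv_eq_iff_eq] at h; exact h.symm)
  have h2 : (π * swap (π⁻¹ a) a) a = a := by simp
  have h3 := cycleCount_mul_swap_of_fixed _ _ _ hx h2
  rw [mul_assoc, Equiv.swap_mul_self, mul_one] at h3
  have h4 := cycleCount_le (π * swap (π⁻¹ a) a)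
  obtain ⟨L, hL, hp, hl⟩ := ih _ (by omega) (π * swap (π⁻¹ a) a) rfl
  refine ⟨L ++ [swap (π⁻¹ a) a], ?_, ?_, ?_⟩
  · intro g hg
    rcases List.mem_append.1 hg with hg | hg
    · exact hL g hg
    · rw [List.mem_singleton.1 hg]
      exact ⟨_, _, hx, rfl⟩
  · rw [List.prod_append, hp, List.prod_singleton, mul_assoc, Equiv.swap_mul_self, mul_one]
  · rw [List.length_append, List.length_singleton]
    omega

theorem invColorings_prod {S : Set (Perm (Fin d))} {c : Fin d → ZMod 2} (hc : c ∈ invColorings S)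
    (L : List (Perm (Fin d))) (hL : ∀ g ∈ L, g ∈ S) : ∀ x, c (L.prod x) = c x := by
  induction L with
  | nil => simp
  | cons g L ih =>
    intro x
    rw [List.prod_cons, Perm.mul_apply, hc g (hL g List.mem_cons_self),
      ih fun g hg => hL g (List.mem_cons_of_mem _ hg)]

theorem cycleCount_add_cycleCount_mul_prod_le (ρ : Perm (Fin d)) (L : List (Perm (Fin d)))
    (hL : ∀ g ∈ L, g.IsSwap) :
    cycleCount ρ + cycleCount (ρ * L.prod) ≤
      L.length + 2 * Module.finrank (ZMod 2) (invColorings {g | g ∈ ρ :: L}) := by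
  induction L using List.reverseRecOn with
  | nil =>
    have : {g : Perm (Fin d) | g ∈ [ρ]} = {ρ} := by ext; simp
    rw [this, finrank_invColorings_singleton]
    simp
    omega
  | append_singleton L s ih =>
    obtain ⟨a, b, hab, rfl⟩ := hL s (by simp)
    have ih := ih fun g hg => hL g (List.mem_append_left _ hg)
    rw [List.prod_append, List.prod_singleton, List.length_append, List.length_singleton,
      ← mul_assoc]
    have hle : invColorings {g | g ∈ ρ :: L} ⊓ agree a b ≤
        invColorings {g | g ∈ ρ :: (L ++ [swap a b])} := by
      rintro c ⟨hc, hcab⟩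
      rw [SetLike.mem_coe, mem_agree] at hcab
      intro g hg x
      rw [← List.cons_append, Set.mem_ofPred_eq, List.mem_append, List.mem_singleton] at hg
      rcases hg with hg | rfl
      · exact hc g hg x
      · rw [swap_apply_def]
        split_ifs with h1 h2
        · rw [h1, hcab]
        · rw [h2, hcab]
        · rfl
    have h1 := Submodule.finrank_mono hle
    by_cases hsep : ∃ χ ∈ invColorings {g | g ∈ ρ :: L}, χ a ≠ χ b
    · obtain ⟨χ, hχ, hχab⟩ := hsep
      have h2 : χ ∈ invColorings {ρ * L.prod} := by
        simp only [mem_invColorings, Set.mem_singleton_iff, forall_eq]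
        have := invColorings_prod hχ (ρ :: L) fun g hg => hg
        simpa using this
      have h3 := cycleCount_mul_swap_of_separated _ a b χ h2 hχab
      have h4 := finrank_le_inf_agree (invColorings {g | g ∈ ρ :: L}) a b
      omega
    · push Not at hsep
      have h2 : invColorings {g | g ∈ ρ :: L} ⊓ agree a b = invColorings {g | g ∈ ρ :: L} :=
        inf_eq_left.2 fun c hc => mem_agree.2 (hsep c hc)
      rw [h2] at h1
      have h3 := cycleCount_mul_swap_le (ρ * L.prod) a b
      omega

end CycleCount

section Factorization

variable {d : ℕ}

/-- Lists of transpositions satisfying the monotone condition. -/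
def IsMonotoneList (l : List (Perm (Fin d))) : Prop :=
  (∀ g ∈ l, g.IsSwap) ∧ l.Pairwise fun g h => g.support.max ≤ h.support.max

variable (d) in
/-- Monotone factorizations `ρ σ τ₁ ⋯ τᵣ = 1`, for all `r`. -/
def Fact : Type :=
  {x : Perm (Fin d) × Perm (Fin d) × List (Perm (Fin d)) //
    IsMonotoneList x.2.2 ∧ x.1 * x.2.1 * x.2.2.prod = 1}

namespace Fact

/-- The permutations occurring in a factorization. -/
def gens (x : Fact d) : List (Perm (Fin d)) := x.1.1 :: x.1.2.1 :: x.1.2.2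

/-- `S` is a union of orbits. -/
def Inv (x : Fact d) (S : Set (Fin d)) : Prop := ∀ g ∈ x.gens, ∀ y, g y ∈ S ↔ y ∈ S

/-- The factorization is transitive. -/
def Conn (x : Fact d) : Prop := ∀ S : Set (Fin d), S.Nonempty → x.Inv S → S = Set.univ

end Fact

theorem cycleCount_pos (hd : 1 ≤ d) (π : Perm (Fin d)) : 1 ≤ cycleCount π := by
  by_contra! h
  have h0 : π.partition.parts = 0 := by
    rw [← Multiset.card_eq_zero]
    exact Nat.lt_one_iff.1 h
  have := π.partition.parts_sum
  rw [h0, Fintype.card_fin] at this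
  simp at this
  omega

theorem sign_prod_of_isSwap (L : List (Perm (Fin d))) (hL : ∀ g ∈ L, g.IsSwap) :
    sign L.prod = (-1) ^ L.length := by
  have := Equiv.Perm.sign_prod_list_swap hL
  exact this

/-- The Riemann–Hurwitz formula for transitive factorizations. -/
theorem Fact.exists_genus (hd : 1 ≤ d) (x : Fact d) (hx : x.Conn) :
    ∃ g, x.1.2.2.length = 2 * g + cycleCount x.1.1 + cycleCount x.1.2.1 - 2 := by
  obtain ⟨⟨ρ, σ, l⟩, ⟨hl, hl'⟩, hprod⟩ := x
  dsimp only at *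
  obtain ⟨L, hL, hLp, hLl⟩ := exists_swap_list _ σ rfl
  obtain ⟨R, hR, hRp, hRl⟩ := exists_swap_list _ ρ rfl
  have h1 := cycleCount_add_cycleCount_mul_prod_le ρ (L ++ l) (by
    intro g hg
    rcases List.mem_append.1 hg with h | h
    · exact hL g h
    · exact hl g h)
  rw [List.prod_append, hLp, ← mul_assoc, hprod, cycleCount_one, List.length_append] at h1
  have h2 : Module.finrank (ZMod 2) (invColorings {g | g ∈ ρ :: (L ++ l)}) ≤ 1 := by
    have hle : invColorings {g | g ∈ ρ :: (L ++ l)} ≤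
        Submodule.span (ZMod 2) {(fun _ => 1 : Fin d → ZMod 2)} := by
      intro c hc
      let x0 : Fin d := ⟨0, hd⟩
      have := hx {x | c x = c x0} ⟨x0, rfl⟩ (by
        intro g hg y
        have : c (g y) = c y := by
          simp only [Fact.gens, List.mem_cons] at hg
          rcases hg with rfl | rfl | hg
          · exact hc g (by simp) y
          · rw [← hLp]
            exact invColorings_prod hc L (fun g hg => by simp [hg]) y
          · exact hc g (by simp [hg]) y
        simp [this])
      rw [Submodule.mem_span_singleton]
      refine ⟨c x0, ?_⟩
      ext y
      have : y ∈ {x | c x = c x0} := this ▸ Set.mem_univ y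
      simpa using this.symm
    refine (Submodule.finrank_mono hle).trans ?_
    exact (finrank_span_le_card _).trans (by simp)
  have h3 : sign ρ * sign σ * sign l.prod = 1 := by
    rw [← map_mul, ← map_mul, hprod, map_one]
  rw [← hRp, ← hLp, sign_prod_of_isSwap _ hL, sign_prod_of_isSwap _ hR, sign_prod_of_isSwap _ hl,
    ← pow_add, ← pow_add] at h3
  have h4 : Even (R.length + L.length + l.length) := by
    by_contra h
    rw [Nat.not_even_iff_odd] at h
    rw [h.neg_one_pow] at h3
    exact absurd h3 (by decide)
  obtain ⟨m, hm⟩ := h4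
  have := cycleCount_le ρ
  have := cycleCount_le σ
  have := cycleCount_pos hd ρ
  have := cycleCount_pos hd σ
  exact ⟨(l.length + 2 - cycleCount ρ - cycleCount σ) / 2, by omega⟩

end Factorization

section Words

variable {d : ℕ}

variable (d) in
/-- Monotone lists of transpositions of elements smaller than `k`. -/
def Word (k : ℕ) : Type :=
  {l : List (Perm (Fin d)) // IsMonotoneList l ∧ ∀ g ∈ l, ∀ j : Fin d, k ≤ j.val → g j = j}

theorem filter_append_filter_not {α : Type*} (p : α → Prop) [DecidablePred p] :
    ∀ l : List α, (l.Pairwise fun a b => p b → p a) →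
      l.filter (fun a => p a) ++ l.filter (fun a => ¬ p a) = l
  | [], _ => rfl
  | a :: l, h => by
    rw [List.pairwise_cons] at h
    have ih := filter_append_filter_not p l h.2
    by_cases ha : p a
    · simpa [ha] using ih
    · have hl : ∀ b ∈ l, ¬ p b := fun b hb hpb => ha (h.1 b hb hpb)
      rw [List.filter_eq_nil_iff.2 (by simpa [ha] using hl),
        List.filter_eq_self.2 (by simpa [ha] using hl), List.nil_append]

/-- The transposition exchanging `i < k` and `k`. -/
def topSwap {k : ℕ} (hk : k < d) (i : Fin k) : Perm (Fin d) :=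
  swap (Fin.castLE hk.le i) ⟨k, hk⟩

theorem topSwap_apply_top {k : ℕ} (hk : k < d) (i : Fin k) :
    topSwap hk i ⟨k, hk⟩ = Fin.castLE hk.le i := swap_apply_right _ _

theorem castLE_ne {k : ℕ} (hk : k < d) (i : Fin k) : Fin.castLE hk.le i ≠ ⟨k, hk⟩ := by
  intro h
  have := congrArg Fin.val h
  simp at this
  omega

theorem topSwap_injective {k : ℕ} (hk : k < d) : Function.Injective (topSwap hk) := by
  intro i j h
  have := congrArg (fun g : Perm (Fin d) => g ⟨k, hk⟩) h
  simpa [topSwap_apply_top] using this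

theorem support_max_topSwap {k : ℕ} (hk : k < d) (i : Fin k) :
    (topSwap hk i).support.max = ((⟨k, hk⟩ : Fin d) : WithBot (Fin d)) := by
  rw [topSwap, support_swap (castLE_ne hk i), Finset.max_insert, Finset.max_singleton,
    ← WithBot.coe_max, max_eq_right]
  exact Fin.le_def.2 i.2.le

theorem support_max_lt {k : ℕ} (hk : k < d) (g : Perm (Fin d))
    (h : ∀ j : Fin d, k ≤ j.val → g j = j) :
    g.support.max < ((⟨k, hk⟩ : Fin d) : WithBot (Fin d)) := by
  rw [Finset.max, Finset.sup_lt_iff (WithBot.bot_lt_coe _)]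
  intro b hb
  rw [WithBot.coe_lt_coe, Fin.lt_def]
  by_contra! hle
  exact (mem_support.1 hb) (h b hle)

theorem exists_topSwap {k : ℕ} (hk : k < d) (g : Perm (Fin d)) (hg : g.IsSwap)
    (h : ∀ j : Fin d, k + 1 ≤ j.val → g j = j) (hne : g ⟨k, hk⟩ ≠ ⟨k, hk⟩) :
    ∃ i, topSwap hk i = g := by
  have hlt : (g ⟨k, hk⟩).val < k := by
    by_contra! hle
    rcases hle.eq_or_lt with h1 | h1
    · exact hne (Fin.ext h1.symm)
    · exact hne (g.injective (h _ h1))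
  refine ⟨⟨_, hlt⟩, ?_⟩
  obtain ⟨a, b, hab, rfl⟩ := hg
  rw [topSwap]
  have : (⟨k, hk⟩ : Fin d) = a ∨ (⟨k, hk⟩ : Fin d) = b := by
    by_contra! hc
    exact hne (swap_apply_of_ne_of_ne hc.1 hc.2)
  rcases this with h1 | h1
  · simp only [h1, swap_apply_left]
    exact Equiv.swap_comm _ _
  · simp only [h1, swap_apply_right]
    rfl

/-- Appending transpositions that move `k` to a word on `{0, …, k-1}`. -/
def Word.extend {k : ℕ} (hk : k < d) (x : Word d k × List (Fin k)) : Word d (k + 1) :=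
  ⟨x.1.1 ++ x.2.map (topSwap hk), by
    obtain ⟨⟨l, ⟨hl1, hl2⟩, hl3⟩, m⟩ := x
    refine ⟨⟨?_, ?_⟩, ?_⟩
    · intro g hg
      rcases List.mem_append.1 hg with h | h
      · exact hl1 g h
      · obtain ⟨i, -, rfl⟩ := List.mem_map.1 h
        exact ⟨_, _, castLE_ne hk i, rfl⟩
    · refine List.pairwise_append.2 ⟨hl2, ?_, ?_⟩
      · rw [List.pairwise_map]
        exact List.pairwise_iff_forall_sublist.2 fun {i j} _ => by
          rw [support_max_topSwap, support_max_topSwap]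
      · intro g hg h hh
        obtain ⟨i, -, rfl⟩ := List.mem_map.1 hh
        rw [support_max_topSwap]
        exact (support_max_lt hk g (hl3 g hg)).le
    · intro g hg j hj
      rcases List.mem_append.1 hg with h | h
      · exact hl3 g h j (by omega)
      · obtain ⟨i, -, rfl⟩ := List.mem_map.1 h
        refine swap_apply_of_ne_of_ne ?_ ?_ <;>
        · intro h
          have := congrArg Fin.val h
          simp at this
          omega⟩

theorem Word.extend_bijective {k : ℕ} (hk : k < d) :
    Function.Bijective (Word.extend (d := d) hk) := by
  constructor
  · rintro ⟨⟨l, hl⟩, m⟩ ⟨⟨l', hl'⟩, m'⟩ h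
    have h1 : l ++ m.map (topSwap hk) = l' ++ m'.map (topSwap hk) := congrArg Subtype.val h
    have key : ∀ (l : List (Perm (Fin d))) (m : List (Fin k)),
        (∀ g ∈ l, ∀ j : Fin d, k ≤ j.val → g j = j) →
        (l ++ m.map (topSwap hk)).filter (fun g => g ⟨k, hk⟩ = ⟨k, hk⟩) = l := by
      intro l m hl
      rw [List.filter_append, List.filter_eq_self.2, List.filter_eq_nil_iff.2, List.append_nil]
      · intro g hg
        obtain ⟨i, -, rfl⟩ := List.mem_map.1 hg
        simpa [topSwap_apply_top] using castLE_ne hk i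
      · intro g hg
        simpa using hl g hg ⟨k, hk⟩ le_rfl
    have h2 : l = l' := by rw [← key l m hl.2, h1, key l' m' hl'.2]
    subst h2
    have h3 := List.map_injective_iff.2 (topSwap_injective hk) (List.append_cancel_left h1)
    rw [h3]
  · rintro ⟨w, ⟨hw1, hw2⟩, hw3⟩
    have hsplit := filter_append_filter_not (fun g : Perm (Fin d) => g ⟨k, hk⟩ = ⟨k, hk⟩) w (by
      refine (List.pairwise_iff_forall_sublist.2 ?_)
      intro g h hgh hh
      by_contra hg
      have hgm := (hgh.subset (by simp : g ∈ [g, h]))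
      have hhm := (hgh.subset (by simp : h ∈ [g, h]))
      obtain ⟨i, rfl⟩ := exists_topSwap hk g (hw1 g hgm) (hw3 g hgm) hg
      have h1 := List.pairwise_iff_forall_sublist.1 hw2 hgh
      rw [support_max_topSwap] at h1
      refine absurd (support_max_lt hk h ?_) (not_lt.2 h1)
      intro j hj
      rcases hj.eq_or_lt with h2 | h2
      · have : j = ⟨k, hk⟩ := Fin.ext h2.symm
        rw [this, hh]
      · exact hw3 h hhm j h2)
    have hr : w.filter (fun g => ¬ g ⟨k, hk⟩ = ⟨k, hk⟩) ∈ Set.range (List.map (topSwap hk)) := by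
      rw [Set.range_list_map]
      intro g hg
      rw [List.mem_filter] at hg
      exact exists_topSwap hk g (hw1 g hg.1) (hw3 g hg.1) (by simpa using hg.2)
    obtain ⟨m, hm⟩ := hr
    refine ⟨⟨⟨w.filter (fun g => g ⟨k, hk⟩ = ⟨k, hk⟩), ⟨?_, ?_⟩, ?_⟩, m⟩, ?_⟩
    · exact fun g hg => hw1 g (List.mem_of_mem_filter hg)
    · exact hw2.filter _
    · intro g hg j hj
      rw [List.mem_filter] at hg
      rcases hj.eq_or_lt with h2 | h2
      · have : j = ⟨k, hk⟩ := Fin.ext h2.symm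
        rw [this]
        simpa using hg.2
      · exact hw3 g hg.1 j h2
    · refine Subtype.ext ?_
      simp only [Word.extend]
      rw [hm]
      exact hsplit

theorem summable_pow_length {k : ℕ} {r : ℝ} (hr : 0 ≤ r) (h : r * k < 1) :
    Summable fun m : List (Fin k) => r ^ m.length := by
  rw [← (List.equivSigmaTuple (α := Fin k)).symm.summable_iff]
  refine (summable_sigma_of_nonneg fun x => by simp; positivity).2 ⟨fun n => ?_, ?_⟩
  · exact (hasSum_fintype _).summable
  · have : Summable fun n : ℕ => (r * k) ^ n := summable_geometric_of_lt_one (by positivity) h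
    refine this.congr fun n => ?_
    rw [tsum_fintype]
    simp [List.equivSigmaTuple, mul_pow, mul_comm]

theorem Word.summable {r : ℝ} (hr : 0 ≤ r) {N : ℕ} (h : r * N ≤ 1) (hN : d ≤ N) :
    ∀ k ≤ d, Summable fun l : Word d k => r ^ l.1.length
  | 0, _ => by
    have : Subsingleton (Word d 0) := by
      refine ⟨?_⟩
      have key : ∀ l : Word d 0, l.1 = [] := by
        rintro ⟨l, hl, hl'⟩
        refine List.eq_nil_iff_forall_not_mem.2 fun g hg => ?_
        obtain ⟨a, b, hab, rfl⟩ := hl.1 g hg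
        have := hl' _ hg a (Nat.zero_le _)
        rw [swap_apply_left] at this
        exact hab this.symm
      intro l l'
      exact Subtype.ext ((key l).trans (key l').symm)
    have : Finite (Word d 0) := Finite.of_subsingleton
    exact Summable.of_finite
  | k + 1, hk => by
    have hk' : k < d := hk
    rw [← (Equiv.ofBijective _ (Word.extend_bijective hk')).summable_iff]
    have h1 := Word.summable hr h hN k hk'.le
    have hrk : r * k < 1 := by
      rcases hr.eq_or_lt with h0 | h0
      · rw [← h0]; simp
      · refine lt_of_lt_of_le ?_ h
        gcongr
        exact_mod_cast hk'.trans_le hN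
    have h2 := summable_pow_length (k := k) hr hrk
    refine (h1.mul_of_nonneg h2 (fun _ => by simp; positivity) (fun _ => by simp; positivity)).congr ?_
    intro x
    simp [Word.extend, pow_add]

end Words

section JucysMurphy

variable {d : ℕ}

theorem summable_mul_finite {ι κ : Type*} [Finite κ] {f : ι → ℂ} (hf : Summable fun i => ‖f i‖)
    (φ : κ → ℂ) (g : ι → κ) : Summable fun i => f i * φ (g i) := by
  have := Fintype.ofFinite κ
  refine Summable.of_norm_bounded (hf.mul_right (∑ u, ‖φ u‖)) fun i => ?_
  rw [norm_mul]
  gcongr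
  exact Finset.single_le_sum (f := fun u => ‖φ u‖) (fun _ _ => norm_nonneg _) (Finset.mem_univ _)

/-- The action of `∑ x ^ length` over words on `{0, …, k-1}` on functions on permutations. -/
noncomputable def wordSum (x : ℂ) (k : ℕ) (φ : Perm (Fin d) → ℂ) (a : Perm (Fin d)) : ℂ :=
  ∑' l : Word d k, x ^ l.1.length * φ (a * l.1.prod)

/-- The action of `∑ x ^ length` over lists of transpositions `(i k)` with `i < k`. -/
noncomputable def topSum (x : ℂ) {k : ℕ} (hk : k < d) (φ : Perm (Fin d) → ℂ)
    (a : Perm (Fin d)) : ℂ :=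
  ∑' m : List (Fin k), x ^ m.length * φ (a * (m.map (topSwap hk)).prod)

theorem summable_norm_pow_list {x : ℂ} {N : ℕ} (hx : ‖x‖ * N ≤ 1) {k : ℕ} (hk : k < N) :
    Summable fun m : List (Fin k) => ‖x ^ m.length‖ := by
  simp only [norm_pow]
  refine summable_pow_length (norm_nonneg x) ?_
  rcases (norm_nonneg x).eq_or_lt with h0 | h0
  · rw [← h0]; simp
  · refine lt_of_lt_of_le ?_ hx
    gcongr

theorem Word.summable_norm_pow {x : ℂ} {N : ℕ} (hx : ‖x‖ * N ≤ 1) (hN : d ≤ N) {k : ℕ}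
    (hk : k ≤ d) : Summable fun l : Word d k => ‖x ^ l.1.length‖ := by
  simp only [norm_pow]
  exact Word.summable (norm_nonneg x) hx hN k hk

theorem wordSum_succ {x : ℂ} {N : ℕ} (hx : ‖x‖ * N ≤ 1) (hN : d ≤ N) {k : ℕ} (hk : k < d)
    (φ : Perm (Fin d) → ℂ) (a : Perm (Fin d)) :
    wordSum x (k + 1) φ a = wordSum x k (topSum x hk φ) a := by
  rw [wordSum, wordSum, ← (Equiv.ofBijective _ (Word.extend_bijective hk)).tsum_eq]
  rw [Summable.tsum_prod]
  · refine tsum_congr fun l => ?_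
    rw [topSum, ← tsum_mul_left]
    refine tsum_congr fun m => ?_
    simp [Word.extend, pow_add, mul_assoc]
  · exact (Equiv.summable_iff (Equiv.ofBijective _ (Word.extend_bijective hk))).2
      (summable_mul_finite (Word.summable_norm_pow hx hN hk) φ fun l => a * l.1.prod)

/-- Lists are empty or have a head and a tail. -/
def listEquivSum (α : Type*) : Unit ⊕ α × List α ≃ List α where
  toFun := Sum.elim (fun _ => []) fun p => p.1 :: p.2
  invFun
    | [] => .inl ()
    | a :: l => .inr (a, l)
  left_inv := by rintro (_ | _) <;> rfl
  right_inv := by rintro (_ | _) <;> rfl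

theorem topSum_eq {x : ℂ} {N : ℕ} (hx : ‖x‖ * N ≤ 1) (hN : d ≤ N) {k : ℕ} (hk : k < d)
    (φ : Perm (Fin d) → ℂ) (a : Perm (Fin d)) :
    topSum x hk φ a = φ a + x * ∑ i, topSum x hk φ (a * topSwap hk i) := by
  let f : List (Fin k) → ℂ := fun m => x ^ m.length * φ (a * (m.map (topSwap hk)).prod)
  have hsum : Summable f := summable_mul_finite
    (summable_norm_pow_list hx (hk.trans_le hN)) φ (fun m => a * (m.map (topSwap hk)).prod)
  have h2 : Summable fun p : Fin k × List (Fin k) => f (p.1 :: p.2) :=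
    hsum.comp_injective (i := fun p : Fin k × List (Fin k) => p.1 :: p.2)
      (fun p q h => Prod.ext (List.cons.inj h).1 (List.cons.inj h).2)
  have h1 : HasSum f (f [] + ∑' p : Fin k × List (Fin k), f (p.1 :: p.2)) := by
    refine (Equiv.hasSum_iff (listEquivSum (Fin k))).1 (HasSum.sum ?_ h2.hasSum)
    exact hasSum_unique _
  refine h1.tsum_eq.trans ?_
  rw [h2.tsum_prod, tsum_fintype, Finset.mul_sum]
  congr 1
  · simp [f]
  · refine Finset.sum_congr rfl fun i _ => ?_
    rw [topSum, ← tsum_mul_left]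
    refine tsum_congr fun m => ?_
    simp [f, pow_succ', mul_assoc]

theorem cycleCount_swap_mul_of_fixed (π : Perm (Fin d)) (a b : Fin d) (hne : a ≠ b)
    (h : π b = b) : cycleCount (swap a b * π) + 1 = cycleCount π := by
  rw [← cycleCount_mul_swap_of_fixed π a b hne h]
  have : IsConj (π * swap a b) (swap a b * π) :=
    isConj_iff.2 ⟨swap a b, by rw [mul_assoc, mul_assoc, swap_inv, Equiv.swap_mul_self, mul_one]⟩
  rw [cycleCount, cycleCount, partition_eq_of_isConj.1 this]

/-- The permutations fixing all elements that are at least `k`. -/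
def fixAbove (d k : ℕ) : Finset (Perm (Fin d)) :=
  Finset.univ.filter fun τ => ∀ j : Fin d, k ≤ j.val → τ j = j

theorem mem_fixAbove {k : ℕ} {τ : Perm (Fin d)} :
    τ ∈ fixAbove d k ↔ ∀ j : Fin d, k ≤ j.val → τ j = j := by
  simp [fixAbove]

theorem sum_fixAbove_succ {k : ℕ} (hk : k < d) (f : Perm (Fin d) → ℂ) :
    ∑ τ ∈ fixAbove d (k + 1), f τ =
      ∑ τ ∈ fixAbove d k, (f τ + ∑ i, f (topSwap hk i * τ)) := by
  let g : Option (Fin k) → Perm (Fin d) := fun o => o.elim 1 (topSwap hk)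
  have hg : ∀ (o : Option (Fin k)) (j : Fin d), k + 1 ≤ j.val → g o j = j := by
    rintro (_ | i) j hj
    · rfl
    · refine swap_apply_of_ne_of_ne ?_ ?_ <;>
      · intro h
        have := congrArg Fin.val h
        simp at this
        omega
  have h1 : ∀ τ, (f τ + ∑ i, f (topSwap hk i * τ)) = ∑ o, f (g o * τ) := by
    intro τ
    rw [Fintype.sum_option]
    simp [g]
  simp only [h1]
  rw [Finset.sum_comm, ← Finset.sum_product']
  symm
  refine Finset.sum_bij (fun p _ => g p.1 * p.2) ?_ ?_ ?_ ?_
  · rintro ⟨o, τ⟩ h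
    rw [Finset.mem_product, mem_fixAbove] at h
    rw [mem_fixAbove]
    intro j hj
    rw [Perm.mul_apply, h.2 j (by omega), hg o j hj]
  · rintro ⟨o, τ⟩ h ⟨o', τ'⟩ h' heq
    rw [Finset.mem_product, mem_fixAbove] at h h'
    dsimp only at heq h h'
    have h2 := congrArg (fun u : Perm (Fin d) => u ⟨k, hk⟩) heq
    simp only [Perm.mul_apply, h.2 ⟨k, hk⟩ le_rfl, h'.2 ⟨k, hk⟩ le_rfl] at h2
    have h3 : o = o' := by
      rcases o with _ | i <;> rcases o' with _ | i'
      · rfl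
      · simp only [g, Option.elim, topSwap_apply_top, Perm.one_apply] at h2
        exact absurd h2.symm (castLE_ne hk i')
      · simp only [g, Option.elim, topSwap_apply_top, Perm.one_apply] at h2
        exact absurd h2 (castLE_ne hk i)
      · simpa [g, topSwap_apply_top] using h2
    subst h3
    rw [mul_left_cancel heq]
  · intro τ hτ
    rw [mem_fixAbove] at hτ
    by_cases h : τ ⟨k, hk⟩ = ⟨k, hk⟩
    · refine ⟨(none, τ), ?_, by simp [g]⟩
      rw [Finset.mem_product, mem_fixAbove]
      refine ⟨Finset.mem_univ _, fun j hj => ?_⟩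
      rcases hj.eq_or_lt with h2 | h2
      · have : j = ⟨k, hk⟩ := Fin.ext h2.symm
        rw [this, h]
      · exact hτ j h2
    · have hlt : (τ ⟨k, hk⟩).val < k := by
        by_contra! hle
        rcases hle.eq_or_lt with h1 | h1
        · exact h (Fin.ext h1.symm)
        · exact h (τ.injective (hτ _ h1))
      refine ⟨(some ⟨_, hlt⟩, topSwap hk ⟨_, hlt⟩ * τ), ?_, ?_⟩
      · rw [Finset.mem_product, mem_fixAbove]
        refine ⟨Finset.mem_univ _, fun j hj => ?_⟩
        rcases hj.eq_or_lt with h2 | h2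
        · have : j = ⟨k, hk⟩ := Fin.ext h2.symm
          rw [this, Perm.mul_apply]
          exact swap_apply_left _ _
        · rw [Perm.mul_apply, hτ j h2]
          exact hg (some _) j h2
      · simp only [g, Option.elim, topSwap, ← mul_assoc]
        rw [Equiv.swap_mul_self, one_mul]
  · intros; rfl

theorem norm_neg_inv_mul_le {N : ℕ} (hN0 : N ≠ 0) : ‖(-(N : ℂ)⁻¹)‖ * N ≤ 1 := by
  rw [norm_neg, norm_inv, Complex.norm_natCast, inv_mul_cancel₀ (by exact_mod_cast hN0)]

theorem sum_fixAbove_wordSum {N : ℕ} (hN0 : N ≠ 0) (hN : d ≤ N) :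
    ∀ k ≤ d, ∀ (φ : Perm (Fin d) → ℂ) (a : Perm (Fin d)),
      ∑ τ ∈ fixAbove d k, (N : ℂ) ^ cycleCount τ * wordSum (-(N : ℂ)⁻¹) k φ (a * τ) =
        (N : ℂ) ^ d * φ a
  | 0, _, φ, a => by
    have h1 : fixAbove d 0 = {1} := by
      ext τ
      rw [mem_fixAbove, Finset.mem_singleton, Equiv.ext_iff]
      simp
    have key : ∀ l : Word d 0, l.1 = [] := by
      rintro ⟨l, hl, hl'⟩
      refine List.eq_nil_iff_forall_not_mem.2 fun g hg => ?_
      obtain ⟨a, b, hab, rfl⟩ := hl.1 g hg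
      have := hl' _ hg a (Nat.zero_le _)
      rw [swap_apply_left] at this
      exact hab this.symm
    let w0 : Word d 0 := ⟨[], ⟨by simp, by simp⟩, by simp⟩
    rw [h1, Finset.sum_singleton, cycleCount_one, wordSum, tsum_eq_single w0]
    · simp [w0]
    · exact fun l hl => absurd (Subtype.ext (key l)) hl
  | k + 1, hk, φ, a => by
    have hk' : k < d := hk
    have hx := norm_neg_inv_mul_le hN0
    have hNc : (N : ℂ) ≠ 0 := by exact_mod_cast hN0
    have ih := sum_fixAbove_wordSum hN0 hN k hk'.le (topSum (-(N : ℂ)⁻¹) hk' φ)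
    rw [sum_fixAbove_succ hk', Finset.sum_add_distrib, Finset.sum_comm]
    simp only [wordSum_succ hx hN hk']
    rw [ih a]
    have h2 : ∀ i, ∑ τ ∈ fixAbove d k, (N : ℂ) ^ cycleCount (topSwap hk' i * τ) *
        wordSum (-(N : ℂ)⁻¹) k (topSum (-(N : ℂ)⁻¹) hk' φ) (a * (topSwap hk' i * τ)) =
        (N : ℂ)⁻¹ * ((N : ℂ) ^ d * topSum (-(N : ℂ)⁻¹) hk' φ (a * topSwap hk' i)) := by
      intro i
      rw [← ih, Finset.mul_sum]
      refine Finset.sum_congr rfl fun τ hτ => ?_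
      rw [mem_fixAbove] at hτ
      rw [← cycleCount_swap_mul_of_fixed τ (Fin.castLE hk'.le i) ⟨k, hk'⟩ (castLE_ne hk' i)
        (hτ _ le_rfl), pow_succ', mul_assoc, inv_mul_cancel_left₀ hNc, mul_assoc]
      rfl
    simp only [h2]
    rw [← Finset.mul_sum, ← Finset.mul_sum, topSum_eq hx hN hk' φ a]
    ring

/-- The generating function of monotone factorizations inverts `π ↦ N ^ cycleCount π`. -/
theorem sum_wordSum {N : ℕ} (hN0 : N ≠ 0) (hN : d ≤ N) (φ : Perm (Fin d) → ℂ)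
    (a : Perm (Fin d)) :
    ∑ τ, (N : ℂ) ^ cycleCount τ * wordSum (-(N : ℂ)⁻¹) d φ (a * τ) = (N : ℂ) ^ d * φ a := by
  rw [← sum_fixAbove_wordSum hN0 hN d le_rfl φ a]
  refine Finset.sum_congr ?_ fun _ _ => rfl
  ext τ
  simp only [Finset.mem_univ, mem_fixAbove, true_iff]
  intro j hj
  omega

end JucysMurphy

section Commutant

variable {N d : ℕ}

/-- The `d`-th tensor power of a matrix. -/
def tensorPow (d : ℕ) (M : Matrix (Fin N) (Fin N) ℂ) :
    Matrix (Fin d → Fin N) (Fin d → Fin N) ℂ :=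
  Matrix.of fun i j => ∏ t, M (i t) (j t)

theorem tensorPow_apply (M : Matrix (Fin N) (Fin N) ℂ) (i j : Fin d → Fin N) :
    tensorPow d M i j = ∏ t, M (i t) (j t) := rfl

theorem tensorPow_mul (M M' : Matrix (Fin N) (Fin N) ℂ) :
    tensorPow d (M * M') = tensorPow d M * tensorPow d M' := by
  ext i j
  simp only [tensorPow_apply, Matrix.mul_apply, ← Finset.prod_mul_distrib]
  rw [Finset.prod_univ_sum, Fintype.piFinset_univ]

theorem tensorPow_diagonal_apply (D : Fin N → ℂ) (i j : Fin d → Fin N) :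
    tensorPow d (diagonal D) i j = if i = j then ∏ t, D (i t) else 0 := by
  rw [tensorPow_apply]
  split_ifs with h
  · subst h; simp
  · obtain ⟨t, ht⟩ := Function.ne_iff.1 h
    exact Finset.prod_eq_zero (Finset.mem_univ t) (Matrix.diagonal_apply_ne _ ht)

theorem tensorPow_diagonal (D : Fin N → ℂ) :
    tensorPow d (diagonal D) = diagonal fun i => ∏ t, D (i t) := by
  ext i j
  rw [tensorPow_diagonal_apply, Matrix.diagonal_apply]

/-- The number of slots carrying the index `a`. -/
def slots (i : Fin d → Fin N) (a : Fin N) : ℕ := (Finset.univ.filter fun t => i t = a).card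

theorem prod_eq_prod_slots (D : Fin N → ℂ) (i : Fin d → Fin N) :
    ∏ t, D (i t) = ∏ a, D a ^ slots i a := by
  rw [← Finset.prod_fiberwise Finset.univ i]
  refine Finset.prod_congr rfl fun a _ => ?_
  rw [slots, ← Finset.prod_const]
  refine Finset.prod_congr rfl fun t ht => ?_
  rw [(Finset.mem_filter.1 ht).2]

variable {Y : Matrix (Fin d → Fin N) (Fin d → Fin N) ℂ}

theorem slots_eq_of_commute
    (hY : ∀ V ∈ Matrix.unitaryGroup (Fin N) ℂ, tensorPow d V * Y = Y * tensorPow d V)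
    (i j : Fin d → Fin N) (hij : Y i j ≠ 0) : slots i = slots j := by
  ext a
  have hprim := Complex.isPrimitiveRoot_exp (d + 1) (by omega)
  set ζ := Complex.exp (2 * Real.pi * Complex.I / (d + 1 : ℕ))
  have hnorm : ‖ζ‖ = 1 := hprim.norm'_eq_one (by omega)
  have hζ : star ζ * ζ = 1 := by
    rw [Complex.star_def, ← Complex.normSq_eq_conj_mul_self, Complex.normSq_eq_norm_sq, hnorm]
    simp
  have hu : diagonal (Function.update (fun _ => (1 : ℂ)) a ζ) ∈ Matrix.unitaryGroup (Fin N) ℂ := by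
    rw [Matrix.mem_unitaryGroup_iff', Matrix.star_eq_conjTranspose, diagonal_conjTranspose,
      diagonal_mul_diagonal, ← diagonal_one]
    congr 1
    ext b
    by_cases hb : b = a
    · subst hb; simpa using hζ
    · simp [hb]
  have h := congrFun (congrFun (hY _ hu) i) j
  rw [tensorPow_diagonal, diagonal_mul, mul_diagonal, mul_comm] at h
  have h' := mul_left_cancel₀ hij h
  rw [prod_eq_prod_slots, prod_eq_prod_slots, Finset.prod_eq_single a, Finset.prod_eq_single a]
    at h'
  · simp only [Function.update_self] at h'
    have hle : ∀ i : Fin d → Fin N, slots i a < d + 1 := fun i =>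
      Nat.lt_succ_of_le ((Finset.card_le_univ _).trans (by simp))
    exact hprim.pow_inj (hle i) (hle j) h'
  all_goals simp +contextual

theorem commute_diagonal
    (hY : ∀ V ∈ Matrix.unitaryGroup (Fin N) ℂ, tensorPow d V * Y = Y * tensorPow d V)
    (D : Fin N → ℂ) : tensorPow d (diagonal D) * Y = Y * tensorPow d (diagonal D) := by
  ext i j
  rw [tensorPow_diagonal, diagonal_mul, mul_diagonal, mul_comm]
  by_cases h : Y i j = 0
  · simp [h]
  · rw [prod_eq_prod_slots, prod_eq_prod_slots, slots_eq_of_commute hY i j h]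

theorem commute_isHermitian
    (hY : ∀ V ∈ Matrix.unitaryGroup (Fin N) ℂ, tensorPow d V * Y = Y * tensorPow d V)
    (H : Matrix (Fin N) (Fin N) ℂ) (hH : H.IsHermitian) :
    tensorPow d H * Y = Y * tensorPow d H := by
  have h1 := hH.spectral_theorem
  rw [Unitary.conjStarAlgAut_apply] at h1
  have hU := hH.eigenvectorUnitary.2
  have hU' : star (hH.eigenvectorUnitary : Matrix (Fin N) (Fin N) ℂ) ∈
    Matrix.unitaryGroup (Fin N) ℂ := Unitary.star_mem hU
  rw [h1, tensorPow_mul, tensorPow_mul]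
  rw [mul_assoc, hY _ hU', ← mul_assoc, mul_assoc _ _ Y, commute_diagonal hY, ← mul_assoc,
    hY _ hU, mul_assoc, mul_assoc, mul_assoc]

theorem commute_tensorPow
    (hY : ∀ V ∈ Matrix.unitaryGroup (Fin N) ℂ, tensorPow d V * Y = Y * tensorPow d V)
    (M : Matrix (Fin N) (Fin N) ℂ) : tensorPow d M * Y = Y * tensorPow d M := by
  obtain ⟨H, K, hH, hK, rfl⟩ : ∃ H K : Matrix (Fin N) (Fin N) ℂ, H.IsHermitian ∧ K.IsHermitian ∧
      M = H + Complex.I • K := by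
    refine ⟨(realPart M : Matrix _ _ ℂ), (imaginaryPart M : Matrix _ _ ℂ),
      (realPart M).2, (imaginaryPart M).2, (realPart_add_I_smul_imaginaryPart M).symm⟩
  ext i j
  let f : ℂ → ℂ := fun s => (tensorPow d (H + s • K) * Y) i j - (Y * tensorPow d (H + s • K)) i j
  have hf : Differentiable ℂ f := by
    simp only [f, Matrix.mul_apply, tensorPow_apply, Matrix.add_apply, Matrix.smul_apply,
      smul_eq_mul]
    fun_prop
  have hreal : ∀ s : ℝ, f s = 0 := by
    intro s
    have : (H + (s : ℂ) • K).IsHermitian := by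
      refine hH.add ?_
      rw [Matrix.IsHermitian, conjTranspose_smul, hK]
      simp
    simp only [f]
    rw [commute_isHermitian hY _ this, sub_self]
  have hz : ∃ᶠ s in nhdsWithin (0 : ℂ) {0}ᶜ, f s = (fun _ => (0 : ℂ)) s := by
    have ht : Filter.Tendsto (fun s : ℝ => (s : ℂ)) (nhdsWithin 0 {0}ᶜ)
        (nhdsWithin (0 : ℂ) {0}ᶜ) := by
      refine tendsto_nhdsWithin_iff.2 ⟨?_, ?_⟩
      · exact (Complex.continuous_ofReal.tendsto' 0 0 (by simp)).mono_left nhdsWithin_le_nhds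
      · filter_upwards [self_mem_nhdsWithin] with s hs
        simpa using hs
    refine ht.frequently (Filter.Eventually.frequently ?_)
    exact Filter.Eventually.of_forall hreal
  have h0 := AnalyticOnNhd.eq_of_frequently_eq
    (hf.differentiableOn.analyticOnNhd isOpen_univ) analyticOnNhd_const hz
  exact sub_eq_zero.1 (congrFun h0 Complex.I)

theorem exists_perm_of_slots_eq {ι j : Fin d → Fin N} (hι : Function.Injective ι)
    (h : slots j = slots ι) : ∃ π : Perm (Fin d), j = ι ∘ π := by
  have h1 : ∀ t, ∃ s, ι s = j t := by
    intro t
    have : 0 < slots ι (j t) := by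
      rw [← h]
      exact Finset.card_pos.2 ⟨t, by simp⟩
    obtain ⟨s, hs⟩ := Finset.card_pos.1 this
    exact ⟨s, by simpa using hs⟩
  choose p hp using h1
  have hinj : Function.Injective p := by
    intro t t' htt
    have hle : slots ι (j t) ≤ 1 := by
      rw [slots, Finset.card_le_one]
      intro a ha b hb
      exact hι ((Finset.mem_filter.1 ha).2.trans (Finset.mem_filter.1 hb).2.symm)
    rw [← h, slots, Finset.card_le_one] at hle
    exact hle t (by simp) t' (by simp [← hp, htt])
  exact ⟨Equiv.ofBijective p (Finite.injective_iff_bijective.1 hinj), funext fun t => (hp t).symm⟩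

/-- The commutant of the tensor powers of unitary matrices is spanned by permutations. -/
theorem exists_coeff_of_commute (hdN : d ≤ N)
    (hY : ∀ V ∈ Matrix.unitaryGroup (Fin N) ℂ, tensorPow d V * Y = Y * tensorPow d V) :
    ∃ c : Perm (Fin d) → ℂ, ∀ i f, Y i f = ∑ π : Perm (Fin d), if i = f ∘ π then c π else 0 := by
  let ι : Fin d → Fin N := Fin.castLE hdN
  have hι : Function.Injective ι := Fin.castLE_injective hdN
  refine ⟨fun π : Perm (Fin d) => Y (ι ∘ π) ι, fun i f => ?_⟩
  let M : Matrix (Fin N) (Fin N) ℂ := Matrix.of fun a b => ∑ t, if b = ι t ∧ a = f t then 1 else 0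
  have hM : ∀ a s, M a (ι s) = if a = f s then 1 else 0 := by
    intro a s
    simp only [M, Matrix.of_apply]
    rw [Finset.sum_eq_single s]
    · simp
    · intro t _ hts
      rw [if_neg]
      exact fun h => hts (hι h.1).symm
    · simp
  have hT : ∀ (j : Fin d → Fin N) (g : Fin d → Fin d),
      tensorPow d M j (ι ∘ g) = if j = f ∘ g then 1 else 0 := by
    intro j g
    simp only [tensorPow_apply, Function.comp_apply, hM]
    rw [Finset.prod_ite_zero]
    simp [funext_iff]
  have h := congrFun (congrFun (commute_tensorPow hY M) i) ι
  rw [Matrix.mul_apply, Matrix.mul_apply] at h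
  have h1 : ∑ j, Y i j * tensorPow d M j ι = Y i f := by
    rw [Finset.sum_eq_single f]
    · simpa using congrArg (Y i f * ·) (hT f id)
    · intro j _ hj
      have := hT j id
      simp only [Function.comp_id] at this
      rw [this, if_neg hj, mul_zero]
    · simp
  rw [h1] at h
  rw [← h]
  symm
  have hinj : Function.Injective fun π : Perm (Fin d) => ι ∘ π := by
    intro π π' hπ
    ext1 t
    exact hι (congrFun hπ t)
  calc ∑ π : Perm (Fin d), (if i = f ∘ π then Y (ι ∘ π) ι else 0)
      = ∑ π : Perm (Fin d), tensorPow d M i (ι ∘ π) * Y (ι ∘ π) ι := by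
        refine Finset.sum_congr rfl fun π _ => ?_
        rw [hT]
        split_ifs <;> simp
    _ = ∑ j ∈ Finset.univ.map ⟨_, hinj⟩, tensorPow d M i j * Y j ι := by
        rw [Finset.sum_map]; rfl
    _ = ∑ j, tensorPow d M i j * Y j ι := by
        refine Finset.sum_subset (Finset.subset_univ _) fun j _ hj => ?_
        have : Y j ι = 0 := by
          by_contra hne
          obtain ⟨π, rfl⟩ := exists_perm_of_slots_eq hι (slots_eq_of_commute hY j ι hne)
          exact hj (Finset.mem_map.2 ⟨π, Finset.mem_univ _, rfl⟩)
        rw [this, mul_zero]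

end Commutant

section HaarMean

variable {N d : ℕ}

instance : CompactSpace (Matrix.unitaryGroup (Fin N) ℂ) := by
  refine isCompact_iff_compactSpace.1 ?_
  have hK : IsCompact (Set.univ.pi fun _ : Fin N => Set.univ.pi fun _ : Fin N =>
      Metric.closedBall (0 : ℂ) 1) :=
    isCompact_univ_pi fun _ => isCompact_univ_pi fun _ => isCompact_closedBall 0 1
  refine hK.of_isClosed_subset (isClosed_unitary (R := Matrix (Fin N) (Fin N) ℂ)) ?_
  intro U hU i _ j _
  rw [mem_closedBall_zero_iff]
  exact entry_norm_bound_of_unitary hU i j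

variable (μ : Measure (Matrix.unitaryGroup (Fin N) ℂ))

theorem integrable_of_continuous [IsFiniteMeasure μ] {f : Matrix.unitaryGroup (Fin N) ℂ → ℂ}
    (hf : Continuous f) : Integrable f μ := by
  obtain ⟨C, hC⟩ := isCompact_univ.exists_bound_of_continuousOn hf.continuousOn
  exact Integrable.of_bound hf.measurable.aestronglyMeasurable C
    (Filter.Eventually.of_forall fun U => hC U (Set.mem_univ U))

/-- The conjugate `U B U⁻¹`. -/
def conjBy (B : Matrix (Fin N) (Fin N) ℂ) (U : Matrix.unitaryGroup (Fin N) ℂ) :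
    Matrix (Fin N) (Fin N) ℂ :=
  (U : Matrix (Fin N) (Fin N) ℂ) * B *
    ((U⁻¹ : Matrix.unitaryGroup (Fin N) ℂ) : Matrix (Fin N) (Fin N) ℂ)

theorem continuous_conjBy (B : Matrix (Fin N) (Fin N) ℂ) : Continuous (conjBy B) := by
  unfold conjBy
  exact (continuous_subtype_val.mul continuous_const).mul
    (continuous_subtype_val.comp continuous_inv)

theorem coe_inv_mul_coe (U : Matrix.unitaryGroup (Fin N) ℂ) :
    ((U⁻¹ : Matrix.unitaryGroup (Fin N) ℂ) : Matrix (Fin N) (Fin N) ℂ) * U = 1 :=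
  congrArg Subtype.val (inv_mul_cancel U)

theorem conjBy_mul (B : Matrix (Fin N) (Fin N) ℂ) (V U : Matrix.unitaryGroup (Fin N) ℂ) :
    conjBy B (V * U) * V = V * conjBy B U := by
  have h : (((V * U)⁻¹ : Matrix.unitaryGroup (Fin N) ℂ) : Matrix (Fin N) (Fin N) ℂ) * V =
      ((U⁻¹ : Matrix.unitaryGroup (Fin N) ℂ) : Matrix (Fin N) (Fin N) ℂ) :=
    congrArg Subtype.val (show (V * U)⁻¹ * V = U⁻¹ by group)
  rw [conjBy, mul_assoc, h, conjBy, Submonoid.coe_mul, mul_assoc, mul_assoc, mul_assoc]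

theorem trace_conjBy_pow (B : Matrix (Fin N) (Fin N) ℂ) (U : Matrix.unitaryGroup (Fin N) ℂ)
    (k : ℕ) : ((conjBy B U) ^ k).trace = (B ^ k).trace := by
  have h : (conjBy B U) ^ k = U * B ^ k *
      ((U⁻¹ : Matrix.unitaryGroup (Fin N) ℂ) : Matrix (Fin N) (Fin N) ℂ) := by
    induction k with
    | zero => simp [Matrix.mem_unitaryGroup_iff.1 U.2]
    | succ k ih =>
      rw [pow_succ, ih, conjBy, pow_succ]
      calc _ = (U : Matrix (Fin N) (Fin N) ℂ) * B ^ k *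
            (((U⁻¹ : Matrix.unitaryGroup (Fin N) ℂ) : Matrix (Fin N) (Fin N) ℂ) * U) * B *
            ((U⁻¹ : Matrix.unitaryGroup (Fin N) ℂ) : Matrix (Fin N) (Fin N) ℂ) := by
            simp only [mul_assoc]
        _ = _ := by rw [coe_inv_mul_coe, mul_one]; simp only [mul_assoc]
  rw [h, Matrix.trace_mul_comm, ← mul_assoc, coe_inv_mul_coe, one_mul]

theorem cycleTrace_conjBy (B : Matrix (Fin N) (Fin N) ℂ) (U : Matrix.unitaryGroup (Fin N) ℂ)
    (σ : Perm (Fin d)) : cycleTrace (conjBy B U) σ = cycleTrace B σ := by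
  let α : d.Partition := ⟨σ.partition.parts, σ.partition.parts_pos, by
    rw [σ.partition.parts_sum, Fintype.card_fin]⟩
  have hα : HasCycleType σ α := rfl
  rw [cycleTrace_eq_pPoly _ σ α hα, cycleTrace_eq_pPoly _ σ α hα, pPoly, pPoly]
  simp only [trace_conjBy_pow]

/-- The average of `(U B U⁻¹)^{⊗ d}`. -/
noncomputable def haarMean (d : ℕ) (B : Matrix (Fin N) (Fin N) ℂ) :
    Matrix (Fin d → Fin N) (Fin d → Fin N) ℂ :=
  Matrix.of fun i j => ∫ U, tensorPow d (conjBy B U) i j ∂μ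

theorem continuous_tensorPow_conjBy (B : Matrix (Fin N) (Fin N) ℂ) (i j : Fin d → Fin N) :
    Continuous fun U => tensorPow d (conjBy B U) i j := by
  simp only [tensorPow_apply]
  exact continuous_finsetProd _ fun t _ => (continuous_conjBy B).matrix_elem _ _

variable [IsProbabilityMeasure μ]

theorem sum_mul_haarMean {κ : Type*} [Fintype κ] (B : Matrix (Fin N) (Fin N) ℂ) (a : κ → ℂ)
    (i j : κ → Fin d → Fin N) :
    ∑ k, a k * haarMean μ d B (i k) (j k) =
      ∫ U, ∑ k, a k * tensorPow d (conjBy B U) (i k) (j k) ∂μ := by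
  rw [integral_finsetSum]
  · simp only [integral_const_mul]
    rfl
  · exact fun k _ => (integrable_of_continuous μ (continuous_tensorPow_conjBy B _ _)).const_mul _

theorem haarMean_commute [μ.IsMulLeftInvariant] (B : Matrix (Fin N) (Fin N) ℂ)
    (V : Matrix (Fin N) (Fin N) ℂ) (hV : V ∈ Matrix.unitaryGroup (Fin N) ℂ) :
    tensorPow d V * haarMean μ d B = haarMean μ d B * tensorPow d V := by
  ext i j
  rw [Matrix.mul_apply, Matrix.mul_apply, sum_mul_haarMean]
  simp only [mul_comm (haarMean μ d B _ _)]
  rw [sum_mul_haarMean]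
  have h := integral_mul_left_eq_self (μ := μ)
    (fun U => ∑ k, tensorPow d V k j * tensorPow d (conjBy B U) i k)
    (⟨V, hV⟩ : Matrix.unitaryGroup (Fin N) ℂ)
  rw [← h]
  refine integral_congr_ae (Filter.Eventually.of_forall fun U => ?_)
  simp only [mul_comm (tensorPow d V _ j)]
  rw [← Matrix.mul_apply, ← Matrix.mul_apply, ← tensorPow_mul, ← tensorPow_mul,
    ← conjBy_mul B ⟨V, hV⟩ U]

theorem cycleTrace_one_eq (π : Perm (Fin d)) :
    (∑ i : Fin d → Fin N, if i = i ∘ π then (1 : ℂ) else 0) = (N : ℂ) ^ cycleCount π := by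
  have h := cycleTrace_one (ι := Fin N) (R := ℂ) π
  rw [Fintype.card_fin] at h
  rw [← h, cycleTrace]
  refine Finset.sum_congr rfl fun i _ => ?_
  simp only [Matrix.one_apply]
  rw [Finset.prod_ite_zero]
  simp [funext_iff]

theorem cycleCount_mul_comm (π σ : Perm (Fin d)) : cycleCount (π * σ) = cycleCount (σ * π) := by
  have : IsConj (π * σ) (σ * π) := isConj_iff.2 ⟨σ, by group⟩
  rw [cycleCount, cycleCount, partition_eq_of_isConj.1 this]

theorem cycleTrace_eq_sum_tensorPow (B : Matrix (Fin N) (Fin N) ℂ) (σ : Perm (Fin d)) :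
    cycleTrace B σ = ∑ i : Fin d → Fin N, 1 * tensorPow d B i (i ∘ σ) := by
  simp only [one_mul]
  rfl

/-- The moments of `Tr(A U B U⁻¹)` in terms of monotone factorizations. -/
theorem integral_trace_pow [μ.IsMulLeftInvariant] (hN0 : N ≠ 0) (hdN : d ≤ N)
    (A B : Matrix (Fin N) (Fin N) ℂ) :
    (N : ℂ) ^ d * ∫ U, (A * conjBy B U).trace ^ d ∂μ =
      ∑ σ : Perm (Fin d), cycleTrace B σ *
        wordSum (-(N : ℂ)⁻¹) d (fun u => cycleTrace A u⁻¹) σ := by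
  obtain ⟨c, hc⟩ := exists_coeff_of_commute hdN (haarMean_commute μ (d := d) B)
  have hB : ∀ σ : Perm (Fin d), cycleTrace B σ = ∑ π, c π * (N : ℂ) ^ cycleCount (π * σ) := by
    intro σ
    calc cycleTrace B σ = ∫ _ : Matrix.unitaryGroup (Fin N) ℂ, cycleTrace B σ ∂μ := by simp
      _ = ∫ U, ∑ i : Fin d → Fin N, 1 * tensorPow d (conjBy B U) i (i ∘ σ) ∂μ := by
        refine integral_congr_ae (Filter.Eventually.of_forall fun U => ?_)
        exact (cycleTrace_conjBy B U σ).symm.trans (cycleTrace_eq_sum_tensorPow _ σ)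
      _ = ∑ i : Fin d → Fin N, 1 * haarMean μ d B i (i ∘ σ) :=
        (sum_mul_haarMean μ B _ _ _).symm
      _ = _ := by
        simp only [hc, one_mul]
        rw [Finset.sum_comm]
        refine Finset.sum_congr rfl fun π _ => ?_
        rw [cycleCount_mul_comm, ← cycleTrace_one_eq, Finset.mul_sum]
        refine Finset.sum_congr rfl fun i _ => ?_
        simp only [mul_ite, mul_one, mul_zero]
        rfl
  have hA : ∫ U, (A * conjBy B U).trace ^ d ∂μ = ∑ π, c π * cycleTrace A π := by
    calc ∫ U, (A * conjBy B U).trace ^ d ∂μ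
        = ∫ U, ∑ p : (Fin d → Fin N) × (Fin d → Fin N),
            tensorPow d A p.1 p.2 * tensorPow d (conjBy B U) p.2 p.1 ∂μ := by
          refine integral_congr_ae (Filter.Eventually.of_forall fun U => ?_)
          have h1 : ∑ p : (Fin d → Fin N) × (Fin d → Fin N),
              tensorPow d A p.1 p.2 * tensorPow d (conjBy B U) p.2 p.1 =
              ∑ i : Fin d → Fin N, ∏ t, (A * conjBy B U) (i t) (i t) := by
            rw [Fintype.sum_prod_type]
            refine Finset.sum_congr rfl fun i _ => ?_
            rw [← tensorPow_apply, tensorPow_mul, Matrix.mul_apply]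
          have h2 := Finset.prod_univ_sum (fun _ : Fin d => (Finset.univ : Finset (Fin N)))
            (fun _ a => (A * conjBy B U) a a)
          rw [Fintype.piFinset_univ, Finset.prod_const, Finset.card_univ, Fintype.card_fin] at h2
          exact h2.trans h1.symm
      _ = ∑ p : (Fin d → Fin N) × (Fin d → Fin N),
            tensorPow d A p.1 p.2 * haarMean μ d B p.2 p.1 :=
          (sum_mul_haarMean μ B _ _ _).symm
      _ = _ := by
          simp only [hc, Finset.mul_sum]
          rw [Finset.sum_comm]
          refine Finset.sum_congr rfl fun π _ => ?_
          rw [Fintype.sum_prod_type, cycleTrace_eq_sum_tensorPow, Finset.mul_sum]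
          refine Finset.sum_congr rfl fun i _ => ?_
          simp [mul_comm]
  rw [hA]
  simp only [hB, Finset.sum_mul]
  rw [Finset.sum_comm, Finset.mul_sum]
  refine Finset.sum_congr rfl fun π _ => ?_
  have h := sum_wordSum hN0 hdN (fun u : Perm (Fin d) => cycleTrace A u⁻¹) π⁻¹
  simp only [inv_inv] at h
  rw [mul_left_comm, ← h, Finset.mul_sum]
  refine (Fintype.sum_equiv (Equiv.mulLeft π⁻¹) _ _ fun σ => ?_)
  simp [mul_assoc]

end HaarMean

section FactSum

variable {N d : ℕ} (A B : Matrix (Fin N) (Fin N) ℂ)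

/-- The weight of a factorization. -/
noncomputable def Fact.weight (z : Fact d) : ℂ :=
  (-(N : ℂ)⁻¹) ^ z.1.2.2.length * (cycleTrace A z.1.1 * cycleTrace B z.1.2.1)

variable (d) in
/-- A factorization is determined by `σ` and the list of transpositions. -/
def factEquiv : Perm (Fin d) × Word d d ≃ Fact d where
  toFun p := ⟨((p.1 * p.2.1.prod)⁻¹, p.1, p.2.1), p.2.2.1, by
    rw [mul_assoc, inv_mul_cancel]⟩
  invFun z := (z.1.2.1, ⟨z.1.2.2, z.2.1, fun _ _ j hj => absurd j.2 (by omega)⟩)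
  left_inv p := rfl
  right_inv z := by
    obtain ⟨⟨ρ, σ, l⟩, h1, h2⟩ := z
    refine Subtype.ext (Prod.ext ?_ rfl)
    rw [mul_assoc] at h2
    exact (eq_inv_of_mul_eq_one_left h2).symm

theorem summable_weight_factEquiv (hN0 : N ≠ 0) (hdN : d ≤ N) :
    Summable fun p : Perm (Fin d) × Word d d => (factEquiv d p).weight A B := by
  have h1 : Summable fun p : Perm (Fin d) × Word d d => ‖(-(N : ℂ)⁻¹) ^ p.2.1.length‖ := by
    have := Summable.mul_of_nonneg (f := fun _ : Perm (Fin d) => (1 : ℝ)) Summable.of_finite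
      (Word.summable_norm_pow (norm_neg_inv_mul_le hN0) hdN (le_refl d))
      (fun _ => zero_le_one) (fun _ => norm_nonneg _)
    simpa using this
  exact summable_mul_finite h1
    (fun q : Perm (Fin d) × Perm (Fin d) => cycleTrace A q.1 * cycleTrace B q.2)
    (fun p => ((p.1 * p.2.1.prod)⁻¹, p.1))

theorem summable_weight (hN0 : N ≠ 0) (hdN : d ≤ N) :
    Summable fun z : Fact d => z.weight A B :=
  (Equiv.summable_iff (factEquiv d)).1 (summable_weight_factEquiv A B hN0 hdN)

variable (d) in
/-- The weighted count of all factorizations. -/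
noncomputable def factSum : ℂ := ∑' z : Fact d, z.weight A B

variable (d) in
/-- The weighted count of transitive factorizations. -/
noncomputable def connSum : ℂ := ∑' z : {z : Fact d // z.Conn}, z.1.weight A B

theorem factSum_eq_integral (μ : Measure (Matrix.unitaryGroup (Fin N) ℂ)) [IsProbabilityMeasure μ]
    [μ.IsMulLeftInvariant] (hN0 : N ≠ 0) (hdN : d ≤ N) :
    factSum d A B = (N : ℂ) ^ d * ∫ U, (A * conjBy B U).trace ^ d ∂μ := by
  rw [integral_trace_pow μ hN0 hdN, factSum, ← (factEquiv d).tsum_eq,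
    (summable_weight_factEquiv A B hN0 hdN).tsum_prod, tsum_fintype]
  refine Finset.sum_congr rfl fun σ _ => ?_
  rw [wordSum, ← tsum_mul_left]
  refine tsum_congr fun l => ?_
  exact (by ring : (-(N : ℂ)⁻¹) ^ l.1.length * (cycleTrace A (σ * l.1.prod)⁻¹ * cycleTrace B σ) =
    cycleTrace B σ * ((-(N : ℂ)⁻¹) ^ l.1.length * cycleTrace A (σ * l.1.prod)⁻¹))

end FactSum

section SortedLists

variable {α β : Type*} [LinearOrder β] (key : α → β) (p : α → Prop) [DecidablePred p]

/-- A sorted list is determined by its two parts, if keys of the parts are different. -/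
theorem eq_of_filter_eq :
    ∀ w w' : List α, (w.Pairwise fun a b => key a ≤ key b) →
      (w'.Pairwise fun a b => key a ≤ key b) →
      (∀ a ∈ w, ∀ b ∈ w, p a → ¬ p b → key a ≠ key b) →
      w.filter (fun a => p a) = w'.filter (fun a => p a) →
      w.filter (fun a => ¬ p a) = w'.filter (fun a => ¬ p a) → w = w'
  | [], w', _, _, _, h1, h2 => by
    refine (List.eq_nil_iff_forall_not_mem.2 fun b hb => ?_).symm
    by_cases hp : p b
    · have : b ∈ w'.filter (fun a => p a) := List.mem_filter.2 ⟨hb, by simpa using hp⟩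
      rw [← h1] at this
      simp at this
    · have : b ∈ w'.filter (fun a => ¬ p a) := List.mem_filter.2 ⟨hb, by simpa using hp⟩
      rw [← h2] at this
      simp at this
  | a :: t, [], _, _, _, h1, h2 => by
    by_cases hp : p a
    · simp [hp] at h1
    · simp [hp] at h2
  | a :: t, b :: t', hw, hw', hk, h1, h2 => by
    have hmem : ∀ c, c ∈ a :: t ↔ c ∈ b :: t' := by
      intro c
      by_cases hp : p c
      · have h3 : c ∈ (a :: t).filter (fun a => p a) ↔ c ∈ (b :: t').filter (fun a => p a) := by
          rw [h1]
        simpa only [List.mem_filter, hp, decide_true, and_true] using h3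
      · have h3 : c ∈ (a :: t).filter (fun a => ¬ p a) ↔
            c ∈ (b :: t').filter (fun a => ¬ p a) := by rw [h2]
        simpa only [List.mem_filter, hp, not_false_eq_true, decide_true, and_true] using h3
    have hle : key a = key b := by
      refine le_antisymm ?_ ?_
      · rcases List.mem_cons.1 ((hmem b).2 (by simp)) with h | h
        · rw [h]
        · exact (List.pairwise_cons.1 hw).1 b h
      · rcases List.mem_cons.1 ((hmem a).1 (by simp)) with h | h
        · rw [h]
        · exact (List.pairwise_cons.1 hw').1 a h
    have hiff : p a ↔ p b := by
      by_contra hne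
      rcases not_iff.1 hne with h
      by_cases hp : p a
      · exact hk a (by simp) b ((hmem b).2 (by simp)) hp (fun hb => (h.2 hb) hp) hle
      · exact hk b ((hmem b).2 (by simp)) a (by simp) (h.1 hp) hp hle.symm
    have hab : a = b ∧ t.filter (fun a => p a) = t'.filter (fun a => p a) ∧
        t.filter (fun a => ¬ p a) = t'.filter (fun a => ¬ p a) := by
      by_cases hp : p a
      · have hpb := hiff.1 hp
        simp only [List.filter_cons, hp, hpb, decide_true, if_true, List.cons.injEq, not_true_eq_false,
          decide_false, Bool.false_eq_true, if_false] at h1 h2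
        exact ⟨h1.1, h1.2, h2⟩
      · have hpb : ¬ p b := fun h => hp (hiff.2 h)
        simp only [List.filter_cons, hp, hpb, decide_true, if_true, List.cons.injEq,
          not_false_eq_true, decide_false, Bool.false_eq_true, if_false] at h1 h2
        exact ⟨h2.1, h1, h2.2⟩
    rw [hab.1, eq_of_filter_eq t t' (List.pairwise_cons.1 hw).2 (List.pairwise_cons.1 hw').2
      (fun a ha b hb => hk a (by simp [ha]) b (by simp [hb])) hab.2.1 hab.2.2]

/-- Sorted lists can be merged. -/
theorem exists_merge (l l' : List α) (hl : l.Pairwise fun a b => key a ≤ key b)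
    (hl' : l'.Pairwise fun a b => key a ≤ key b) (hp : ∀ a ∈ l, p a) (hp' : ∀ a ∈ l', ¬ p a) :
    ∃ w : List α, (w.Pairwise fun a b => key a ≤ key b) ∧
      w.filter (fun a => p a) = l ∧ w.filter (fun a => ¬ p a) = l' := by
  let le : α → α → Bool := fun a b => decide (key a ≤ key b)
  have htrans : ∀ a b c, le a b = true → le b c = true → le a c = true := by
    intro a b c h1 h2
    simp only [le, decide_eq_true_eq] at *
    exact h1.trans h2
  have htot : ∀ a b, (le a b || le b a) = true := by
    intro a b
    simpa [le] using le_total (key a) (key b)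
  have hperm := List.mergeSort_perm (l ++ l') le
  have e1 : l.filter (fun a => p a) = l := List.filter_eq_self.2 (by simpa using hp)
  have e2 : l'.filter (fun a => p a) = [] := List.filter_eq_nil_iff.2 (by simpa using hp')
  have e3 : l.filter (fun a => ¬ p a) = [] := List.filter_eq_nil_iff.2 (by simpa using hp)
  have e4 : l'.filter (fun a => ¬ p a) = l' := List.filter_eq_self.2 (by simpa using hp')
  refine ⟨(l ++ l').mergeSort le, ?_, ?_, ?_⟩
  · simpa [le] using List.pairwise_mergeSort htrans htot (l ++ l')
  · symm
    have hsub := (List.sublist_mergeSort htrans htot (by simpa [le] using hl)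
      (List.sublist_append_left l l')).filter (fun a => p a)
    rw [e1] at hsub
    refine hsub.eq_of_length ?_
    rw [(hperm.filter _).length_eq, List.filter_append, e1, e2, List.append_nil]
  · symm
    have hsub := (List.sublist_mergeSort htrans htot (by simpa [le] using hl')
      (List.sublist_append_right l l')).filter (fun a => ¬ p a)
    rw [e4] at hsub
    refine hsub.eq_of_length ?_
    rw [(hperm.filter _).length_eq, List.filter_append, e3, e4, List.nil_append]

theorem map_prod_eq_filter {G H : Type*} [Monoid H] (f : G → H) (p : G → Prop)
    [DecidablePred p] : ∀ w : List G, (∀ g ∈ w, ¬ p g → f g = 1) →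
      (w.map f).prod = ((w.filter (fun a => p a)).map f).prod
  | [], _ => rfl
  | g :: w, h => by
    have ih := map_prod_eq_filter f p w fun g hg => h g (by simp [hg])
    by_cases hp : p g
    · simp [hp, ih]
    · simp [hp, ih, h g (by simp) hp]

end SortedLists

section GlueSwap

variable {p q n : ℕ} (e : Fin p ⊕ Fin q ≃ Fin n)

theorem support_max_of_isSwap {u : Perm (Fin p)} (hu : u.IsSwap)
    (hl : StrictMono fun a => e (Sum.inl a)) :
    ∃ c : Fin p, u.support.max = (c : WithBot (Fin p)) ∧
      (glue e (u, 1)).support.max = (e (Sum.inl c) : WithBot (Fin n)) := by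
  obtain ⟨a, b, hab, rfl⟩ := hu
  refine ⟨max a b, ?_, ?_⟩
  · rw [support_swap hab, Finset.max_insert, Finset.max_singleton, ← WithBot.coe_max]
  · rw [glue_swap_left, support_swap (fun h => hab (hl.injective h)), Finset.max_insert,
      Finset.max_singleton, ← WithBot.coe_max]
    exact congrArg _ (hl.monotone.map_max).symm

theorem support_max_of_isSwap' {v : Perm (Fin q)} (hv : v.IsSwap)
    (hr : StrictMono fun a => e (Sum.inr a)) :
    ∃ c : Fin q, v.support.max = (c : WithBot (Fin q)) ∧
      (glue e (1, v)).support.max = (e (Sum.inr c) : WithBot (Fin n)) := by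
  obtain ⟨a, b, hab, rfl⟩ := hv
  refine ⟨max a b, ?_, ?_⟩
  · rw [support_swap hab, Finset.max_insert, Finset.max_singleton, ← WithBot.coe_max]
  · rw [glue_swap_right, support_swap (fun h => hab (hr.injective h)), Finset.max_insert,
      Finset.max_singleton, ← WithBot.coe_max]
    exact congrArg _ (hr.monotone.map_max).symm

theorem isSwap_of_glue {x : Perm (Fin p) × Perm (Fin q)} (h : (glue e x).IsSwap) :
    (x.1.IsSwap ∧ x.2 = 1) ∨ (x.1 = 1 ∧ x.2.IsSwap) := by
  obtain ⟨a, b, hab, h⟩ := h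
  rcases sum_equiv_cases e a with ⟨a, rfl⟩ | ⟨a, rfl⟩ <;>
    rcases sum_equiv_cases e b with ⟨b, rfl⟩ | ⟨b, rfl⟩
  · left
    have hab' : a ≠ b := fun h => hab (by rw [h])
    rw [← glue_swap_left] at h
    rw [glue_injective e h]
    exact ⟨⟨a, b, hab', rfl⟩, rfl⟩
  · have := glue_inl e x a
    rw [h, swap_apply_left] at this
    simp at this
  · have := glue_inr e x a
    rw [h, swap_apply_left] at this
    simp at this
  · right
    have hab' : a ≠ b := fun h => hab (by rw [h])
    rw [← glue_swap_right] at h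
    rw [glue_injective e h]
    exact ⟨rfl, ⟨a, b, hab', rfl⟩⟩

theorem isSwap_glue_left {u : Perm (Fin p)} (hu : u.IsSwap) : (glue e (u, 1)).IsSwap := by
  obtain ⟨a, b, hab, rfl⟩ := hu
  exact ⟨_, _, fun h => hab (Sum.inl_injective (e.injective h)), glue_swap_left e a b⟩

theorem isSwap_glue_right {v : Perm (Fin q)} (hv : v.IsSwap) : (glue e (1, v)).IsSwap := by
  obtain ⟨a, b, hab, rfl⟩ := hv
  exact ⟨_, _, fun h => hab (Sum.inr_injective (e.injective h)), glue_swap_right e a b⟩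

theorem isSwap_ne_one {u : Perm (Fin p)} (hu : u.IsSwap) : u ≠ 1 := by
  obtain ⟨a, b, hab, rfl⟩ := hu
  exact fun h => hab (swap_eq_one_iff.1 h)

end GlueSwap

section Glued

variable {p q n : ℕ} (e : Fin p ⊕ Fin q ≃ Fin n)

/-- `m` interleaves two lists of permutations of the two pieces. -/
def Interleaves (m : List (Perm (Fin p) × Perm (Fin q))) (l : List (Perm (Fin p)))
    (l' : List (Perm (Fin q))) : Prop :=
  m.filter (fun g => g.2 = 1) = l.map (fun u => (u, 1)) ∧
    m.filter (fun g => ¬ g.2 = 1) = l'.map (fun v => (1, v))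

theorem Interleaves.mem_iff {m : List (Perm (Fin p) × Perm (Fin q))} {l : List (Perm (Fin p))}
    {l' : List (Perm (Fin q))} (h : Interleaves m l l') (g : Perm (Fin p) × Perm (Fin q)) :
    g ∈ m ↔ (∃ u ∈ l, g = (u, 1)) ∨ ∃ v ∈ l', g = (1, v) := by
  have h1 : g ∈ m ↔ g ∈ m.filter (fun g => g.2 = 1) ∨ g ∈ m.filter (fun g => ¬ g.2 = 1) := by
    simp only [List.mem_filter, decide_eq_true_eq]
    tauto
  rw [h1, h.1, h.2]
  simp only [List.mem_map, eq_comm]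

theorem Interleaves.prod_eq {m : List (Perm (Fin p) × Perm (Fin q))} {l : List (Perm (Fin p))}
    {l' : List (Perm (Fin q))} (h : Interleaves m l l') : m.prod = (l.prod, l'.prod) := by
  refine Prod.ext ?_ ?_
  · have h1 := map_prod_eq_filter (fun g : Perm (Fin p) × Perm (Fin q) => g.1)
      (fun g => g.2 = 1) m (by
        intro g hg hg2
        rcases (h.mem_iff g).1 hg with ⟨u, _, rfl⟩ | ⟨v, _, rfl⟩
        · exact absurd rfl hg2
        · rfl)
    rw [h.1, List.map_map] at h1
    have h2 : ((fun g : Perm (Fin p) × Perm (Fin q) => g.1) ∘ fun u => (u, 1)) = id := rfl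
    rw [h2, List.map_id] at h1
    rw [← h1]
    exact (List.prod_hom m (MonoidHom.fst (Perm (Fin p)) (Perm (Fin q)))).symm
  · have h1 := map_prod_eq_filter (fun g : Perm (Fin p) × Perm (Fin q) => g.2)
      (fun g => ¬ g.2 = 1) m (fun g _ hg2 => not_not.1 hg2)
    rw [h.2, List.map_map] at h1
    have h2 : ((fun g : Perm (Fin p) × Perm (Fin q) => g.2) ∘ fun u => (1, u)) = id := rfl
    rw [h2, List.map_id] at h1
    rw [← h1]
    exact (List.prod_hom m (MonoidHom.snd (Perm (Fin p)) (Perm (Fin q)))).symm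

theorem Interleaves.length_eq {m : List (Perm (Fin p) × Perm (Fin q))} {l : List (Perm (Fin p))}
    {l' : List (Perm (Fin q))} (h : Interleaves m l l') : m.length = l.length + l'.length := by
  have h1 := m.length_eq_length_filter_add (fun g => decide (g.2 = 1))
  have h2 : (fun g : Perm (Fin p) × Perm (Fin q) => !decide (g.2 = 1)) =
      fun g => decide (¬ g.2 = 1) := by
    ext g
    simp
  rw [h2, h.1, h.2, List.length_map, List.length_map] at h1
  exact h1

/-- `z` is obtained by gluing `x` and `y` and merging the lists of transpositions. -/
def Glued (x : Fact p) (y : Fact q) (z : Fact n) : Prop :=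
  z.1.1 = glue e (x.1.1, y.1.1) ∧ z.1.2.1 = glue e (x.1.2.1, y.1.2.1) ∧
    ∃ m, z.1.2.2 = m.map (glue e) ∧ Interleaves m x.1.2.2 y.1.2.2

variable {e} {x x' : Fact p} {y y' : Fact q} {z z' : Fact n}

theorem map_injective_left : Function.Injective
    (List.map fun u : Perm (Fin p) => (u, (1 : Perm (Fin q)))) :=
  List.map_injective_iff.2 fun _ _ h => congrArg Prod.fst h

theorem map_injective_right : Function.Injective
    (List.map fun v : Perm (Fin q) => ((1 : Perm (Fin p)), v)) :=
  List.map_injective_iff.2 fun _ _ h => congrArg Prod.snd h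

theorem Glued.unique_left (h : Glued e x y z) (h' : Glued e x' y' z) : x = x' ∧ y = y' := by
  obtain ⟨h1, h2, m, h3, h4, h5⟩ := h
  obtain ⟨h1', h2', m', h3', h4', h5'⟩ := h'
  have e1 := glue_injective e (h1.symm.trans h1')
  have e2 := glue_injective e (h2.symm.trans h2')
  have e3 := List.map_injective_iff.2 (glue_injective e) (h3.symm.trans h3')
  subst e3
  rw [h4] at h4'
  rw [h5] at h5'
  have e4 := map_injective_left h4'
  have e5 := map_injective_right h5'
  rw [Prod.mk.injEq] at e1 e2
  exact ⟨Subtype.ext (Prod.ext e1.1 (Prod.ext e2.1 e4)),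
    Subtype.ext (Prod.ext e1.2 (Prod.ext e2.2 e5))⟩

theorem Glued.unique_right (hl : StrictMono fun a => e (Sum.inl a))
    (hr : StrictMono fun a => e (Sum.inr a)) (h : Glued e x y z) (h' : Glued e x y z') :
    z = z' := by
  obtain ⟨h1, h2, m, h3, h4⟩ := h
  obtain ⟨h1', h2', m', h3', h4'⟩ := h'
  have hm : m = m' := by
    refine eq_of_filter_eq (fun g => (glue e g).support.max) (fun g => g.2 = 1) m m' ?_ ?_ ?_
      (h4.1.trans h4'.1.symm) (h4.2.trans h4'.2.symm)
    · have := z.2.1.2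
      rwa [h3, List.pairwise_map] at this
    · have := z'.2.1.2
      rwa [h3', List.pairwise_map] at this
    · intro g hg g' hg' hp hp'
      rcases (h4.mem_iff g).1 hg with ⟨u, hu, rfl⟩ | ⟨v, hv, rfl⟩
      · rcases (h4.mem_iff g').1 hg' with ⟨u', hu', rfl⟩ | ⟨v, hv, rfl⟩
        · exact absurd rfl hp'
        · obtain ⟨c, -, hc⟩ := support_max_of_isSwap e (x.2.1.1 u hu) hl
          obtain ⟨c', -, hc'⟩ := support_max_of_isSwap' e (y.2.1.1 v hv) hr
          rw [hc, hc']
          simp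
      · exact absurd hp (isSwap_ne_one (y.2.1.1 v hv))
  refine Subtype.ext (Prod.ext (h1.trans h1'.symm) (Prod.ext (h2.trans h2'.symm) ?_))
  rw [h3, h3', hm]

theorem exists_glued (hl : StrictMono fun a => e (Sum.inl a))
    (hr : StrictMono fun a => e (Sum.inr a)) (x : Fact p) (y : Fact q) :
    ∃ z, Glued e x y z := by
  obtain ⟨m, hm1, hm2, hm3⟩ := exists_merge (fun g => (glue e g).support.max) (fun g => g.2 = 1)
    (x.1.2.2.map fun u => (u, 1)) (y.1.2.2.map fun v => (1, v)) (by
      rw [List.pairwise_map]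
      refine x.2.1.2.imp_of_mem fun {u u'} hu hu' h => ?_
      obtain ⟨c, h1, h2⟩ := support_max_of_isSwap e (x.2.1.1 u hu) hl
      obtain ⟨c', h1', h2'⟩ := support_max_of_isSwap e (x.2.1.1 u' hu') hl
      rw [h1, h1', WithBot.coe_le_coe] at h
      rw [h2, h2', WithBot.coe_le_coe]
      exact hl.monotone h) (by
      rw [List.pairwise_map]
      refine y.2.1.2.imp_of_mem fun {u u'} hu hu' h => ?_
      obtain ⟨c, h1, h2⟩ := support_max_of_isSwap' e (y.2.1.1 u hu) hr
      obtain ⟨c', h1', h2'⟩ := support_max_of_isSwap' e (y.2.1.1 u' hu') hr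
      rw [h1, h1', WithBot.coe_le_coe] at h
      rw [h2, h2', WithBot.coe_le_coe]
      exact hr.monotone h) (by simp) (by
      intro g hg
      obtain ⟨v, hv, rfl⟩ := List.mem_map.1 hg
      exact isSwap_ne_one (y.2.1.1 v hv))
  have hm : Interleaves m x.1.2.2 y.1.2.2 := ⟨hm2, hm3⟩
  refine ⟨⟨(glue e (x.1.1, y.1.1), glue e (x.1.2.1, y.1.2.1), m.map (glue e)), ⟨?_, ?_⟩, ?_⟩,
    rfl, rfl, m, rfl, hm⟩
  · intro g hg
    obtain ⟨g', hg', rfl⟩ := List.mem_map.1 hg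
    rcases (hm.mem_iff g').1 hg' with ⟨u, hu, rfl⟩ | ⟨v, hv, rfl⟩
    · exact isSwap_glue_left e (x.2.1.1 u hu)
    · exact isSwap_glue_right e (y.2.1.1 v hv)
  · rw [List.pairwise_map]
    exact hm1
  · dsimp only
    rw [List.prod_hom, hm.prod_eq, ← map_mul, ← map_mul, Prod.mk_mul_mk, Prod.mk_mul_mk, x.2.2,
      y.2.2]
    exact map_one _

theorem exists_glued_of_inv (hl : StrictMono fun a => e (Sum.inl a))
    (hr : StrictMono fun a => e (Sum.inr a)) (z : Fact n)
    (hz : z.Inv (Set.range fun a => e (Sum.inl a))) : ∃ x y, Glued e x y z := by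
  have hglue : ∀ g ∈ z.gens, ∃ a, glue e a = g := by
    intro g hg
    refine mem_range_glue e g fun u => ?_
    obtain ⟨u', hu'⟩ := (hz g hg (e (Sum.inl u))).2 ⟨u, rfl⟩
    exact ⟨u', hu'.symm⟩
  obtain ⟨⟨ρ, σ, l⟩, ⟨hz1, hz2⟩, hz3⟩ := z
  dsimp only at hz1 hz2 hz3
  obtain ⟨a, ha⟩ := hglue ρ (by simp [Fact.gens])
  obtain ⟨b, hb⟩ := hglue σ (by simp [Fact.gens])
  have hlm : l ∈ Set.range (List.map (glue e)) := by
    rw [Set.range_list_map]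
    exact fun g hg => hglue g (by simp [Fact.gens, hg])
  obtain ⟨m, rfl⟩ := hlm
  subst ha hb
  rw [List.prod_hom, ← map_mul, ← map_mul] at hz3
  have hprod := glue_injective e (hz3.trans (map_one (glue e)).symm)
  have hswap : ∀ g ∈ m, (g.1.IsSwap ∧ g.2 = 1) ∨ (g.1 = 1 ∧ g.2.IsSwap) := fun g hg =>
    isSwap_of_glue e (hz1 _ (List.mem_map_of_mem hg))
  rw [List.pairwise_map] at hz2
  let l₁ := (m.filter (fun g => g.2 = 1)).map Prod.fst
  let l₂ := (m.filter (fun g => ¬ g.2 = 1)).map Prod.snd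
  have hm : Interleaves m l₁ l₂ := by
    constructor
    · rw [List.map_map]
      refine (List.map_id _).symm.trans (List.map_congr_left fun g hg => ?_)
      rw [List.mem_filter, decide_eq_true_eq] at hg
      exact Prod.ext rfl hg.2
    · rw [List.map_map]
      refine (List.map_id _).symm.trans (List.map_congr_left fun g hg => ?_)
      rw [List.mem_filter, decide_eq_true_eq] at hg
      exact Prod.ext ((hswap g hg.1).resolve_left fun h => hg.2 h.2).1 rfl
  have hs₁ : ∀ u ∈ l₁, u.IsSwap := by
    intro u hu
    obtain ⟨g, hg, rfl⟩ := List.mem_map.1 hu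
    rw [List.mem_filter, decide_eq_true_eq] at hg
    rcases hswap g hg.1 with h | h
    · exact h.1
    · exact absurd hg.2 (isSwap_ne_one h.2)
  have hs₂ : ∀ v ∈ l₂, v.IsSwap := by
    intro u hu
    obtain ⟨g, hg, rfl⟩ := List.mem_map.1 hu
    rw [List.mem_filter, decide_eq_true_eq] at hg
    rcases hswap g hg.1 with h | h
    · exact absurd h.2 hg.2
    · exact h.2
  have h1 : l₁.Pairwise fun g h => g.support.max ≤ h.support.max := by
    have h := hz2.filter (fun g => g.2 = 1)
    rw [hm.1, List.pairwise_map] at h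
    refine h.imp_of_mem fun {u u'} hu hu' h => ?_
    obtain ⟨c, h1, h2⟩ := support_max_of_isSwap e (hs₁ u hu) hl
    obtain ⟨c', h1', h2'⟩ := support_max_of_isSwap e (hs₁ u' hu') hl
    rw [h2, h2', WithBot.coe_le_coe, hl.le_iff_le] at h
    rwa [h1, h1', WithBot.coe_le_coe]
  have h2 : l₂.Pairwise fun g h => g.support.max ≤ h.support.max := by
    have h := hz2.filter (fun g => ¬ g.2 = 1)
    rw [hm.2, List.pairwise_map] at h
    refine h.imp_of_mem fun {u u'} hu hu' h => ?_
    obtain ⟨c, h1, h2⟩ := support_max_of_isSwap' e (hs₂ u hu) hr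
    obtain ⟨c', h1', h2'⟩ := support_max_of_isSwap' e (hs₂ u' hu') hr
    rw [h2, h2', WithBot.coe_le_coe, hr.le_iff_le] at h
    rwa [h1, h1', WithBot.coe_le_coe]
  rw [hm.prod_eq] at hprod
  exact ⟨⟨(a.1, b.1, l₁), ⟨hs₁, h1⟩, congrArg Prod.fst hprod⟩,
    ⟨(a.2, b.2, l₂), ⟨hs₂, h2⟩, congrArg Prod.snd hprod⟩, rfl, rfl, m, rfl, hm⟩

theorem Glued.weight_eq {N : ℕ} (A B : Matrix (Fin N) (Fin N) ℂ) (h : Glued e x y z) :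
    z.weight A B = x.weight A B * y.weight A B := by
  obtain ⟨h1, h2, m, h3, h4⟩ := h
  rw [Fact.weight, h1, h2, h3, List.length_map, h4.length_eq, cycleTrace_glue, cycleTrace_glue,
    Fact.weight, Fact.weight, pow_add]
  ring

theorem Glued.inv_iff (h : Glued e x y z) (T : Set (Fin n)) :
    z.Inv T ↔ x.Inv {u | e (Sum.inl u) ∈ T} ∧ y.Inv {v | e (Sum.inr v) ∈ T} := by
  have key : ∀ g : Perm (Fin p) × Perm (Fin q), (∀ a, glue e g a ∈ T ↔ a ∈ T) ↔
      (∀ u, e (Sum.inl (g.1 u)) ∈ T ↔ e (Sum.inl u) ∈ T) ∧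
      ∀ v, e (Sum.inr (g.2 v)) ∈ T ↔ e (Sum.inr v) ∈ T := by
    intro g
    constructor
    · intro h
      exact ⟨fun u => by simpa using h (e (Sum.inl u)), fun u => by simpa using h (e (Sum.inr u))⟩
    · intro h a
      rcases sum_equiv_cases e a with ⟨u, rfl⟩ | ⟨u, rfl⟩
      · rw [glue_inl]; exact h.1 u
      · rw [glue_inr]; exact h.2 u
  obtain ⟨h1, h2, m, h3, h4⟩ := h
  simp only [Fact.Inv, Fact.gens, List.forall_mem_cons, h1, h2, h3, List.forall_mem_map, key,
    Set.mem_ofPred_eq]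
  have h5 : (∀ g ∈ m, (∀ u, e (Sum.inl (g.1 u)) ∈ T ↔ e (Sum.inl u) ∈ T) ∧
      ∀ v, e (Sum.inr (g.2 v)) ∈ T ↔ e (Sum.inr v) ∈ T) ↔
      (∀ g ∈ x.1.2.2, ∀ u, e (Sum.inl (g u)) ∈ T ↔ e (Sum.inl u) ∈ T) ∧
      ∀ g ∈ y.1.2.2, ∀ v, e (Sum.inr (g v)) ∈ T ↔ e (Sum.inr v) ∈ T := by
    constructor
    · intro h
      exact ⟨fun g hg => (h (g, 1) ((h4.mem_iff _).2 (Or.inl ⟨g, hg, rfl⟩))).1,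
        fun g hg => (h (1, g) ((h4.mem_iff _).2 (Or.inr ⟨g, hg, rfl⟩))).2⟩
    · intro h g hg
      rcases (h4.mem_iff g).1 hg with ⟨u, hu, rfl⟩ | ⟨v, hv, rfl⟩
      · exact ⟨h.1 u hu, fun _ => Iff.rfl⟩
      · exact ⟨fun _ => Iff.rfl, h.2 v hv⟩
  rw [h5]
  tauto

end Glued

section Splitting

open Classical in
/-- The orbit of `0` under the permutations of a factorization. -/
noncomputable def Fact.orb {n : ℕ} (z : Fact (n + 1)) : Finset (Fin (n + 1)) :=
  Finset.univ.filter fun y => ∀ T : Set (Fin (n + 1)), z.Inv T → 0 ∈ T → y ∈ T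

variable {p q n : ℕ}

theorem Fact.mem_orb {z : Fact (n + 1)} {y : Fin (n + 1)} :
    y ∈ z.orb ↔ ∀ T : Set (Fin (n + 1)), z.Inv T → 0 ∈ T → y ∈ T := by
  simp [Fact.orb]

theorem Fact.inv_orb (z : Fact (n + 1)) : z.Inv (z.orb : Set (Fin (n + 1))) := by
  intro g hg y
  simp only [Finset.mem_coe, Fact.mem_orb]
  exact forall_congr' fun T => forall_congr' fun hT => by rw [hT g hg y]

theorem Fact.zero_mem_orb (z : Fact (n + 1)) : 0 ∈ z.orb :=
  Fact.mem_orb.2 fun _ _ h => h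

theorem Fact.inv_univ {d : ℕ} (y : Fact d) : y.Inv Set.univ := fun _ _ _ => by simp

theorem Fact.inv_empty {d : ℕ} (y : Fact d) : y.Inv ∅ := fun _ _ _ => by simp

theorem Fact.Inv.compl {d : ℕ} {y : Fact d} {T : Set (Fin d)} (h : y.Inv T) : y.Inv Tᶜ :=
  fun g hg a => not_congr (h g hg a)

variable {e : Fin p ⊕ Fin q ≃ Fin (n + 1)} {x : Fact p} {y : Fact q} {z : Fact (n + 1)}
  {u₀ : Fin p}

theorem Glued.coe_orb_eq (h : Glued e x y z) (hu : e (Sum.inl u₀) = 0) (hx : x.Conn) :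
    (z.orb : Set (Fin (n + 1))) = Set.range fun a => e (Sum.inl a) := by
  apply Set.Subset.antisymm
  · intro a ha
    refine Fact.mem_orb.1 ha _ ((h.inv_iff _).2 ⟨?_, ?_⟩) ⟨u₀, hu⟩
    · convert x.inv_univ
      simp
    · convert y.inv_empty
      ext
      simp
  · have h1 := hx _ ⟨u₀, by
      rw [Set.mem_ofPred_eq, hu]
      exact z.zero_mem_orb⟩ ((h.inv_iff _).1 z.inv_orb).1
    rintro _ ⟨a, rfl⟩
    exact h1.ge (Set.mem_univ a)

theorem Glued.conn_of_coe_orb_eq (h : Glued e x y z) (hu : e (Sum.inl u₀) = 0)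
    (hz : (z.orb : Set (Fin (n + 1))) = Set.range fun a => e (Sum.inl a)) : x.Conn := by
  have key : ∀ T : Set (Fin p), x.Inv T → u₀ ∈ T → T = Set.univ := by
    intro T hT h0
    refine Set.eq_univ_of_forall fun u => ?_
    have hu' : e (Sum.inl u) ∈ z.orb := by
      rw [← Finset.mem_coe, hz]
      exact ⟨u, rfl⟩
    have h1 := Fact.mem_orb.1 hu' ((fun a => e (Sum.inl a)) '' T) ((h.inv_iff _).2 ⟨?_, ?_⟩)
      ⟨u₀, h0, hu⟩
    · simpa using h1
    · convert hT
      simp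
    · convert y.inv_empty
      ext
      simp
  intro T hT hi
  by_cases h0 : u₀ ∈ T
  · exact key T hi h0
  · have := key Tᶜ hi.compl h0
    rw [Set.compl_univ_iff] at this
    exact absurd this hT.ne_empty

variable (e) in
/-- The gluing of two factorizations along order-preserving labellings. -/
noncomputable def glueFact (hl : StrictMono fun a => e (Sum.inl a))
    (hr : StrictMono fun a => e (Sum.inr a)) (x : Fact p) (y : Fact q) : Fact (n + 1) :=
  (exists_glued hl hr x y).choose

theorem glued_glueFact (hl : StrictMono fun a => e (Sum.inl a))
    (hr : StrictMono fun a => e (Sum.inr a)) (x : Fact p) (y : Fact q) :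
    Glued e x y (glueFact e hl hr x y) :=
  (exists_glued hl hr x y).choose_spec

/-- Factorizations whose orbit of `0` is `S` split into a transitive factorization on `S`
and an arbitrary factorization on the complement. -/
noncomputable def glueEquiv (hl : StrictMono fun a => e (Sum.inl a))
    (hr : StrictMono fun a => e (Sum.inr a)) (hu : e (Sum.inl u₀) = 0)
    (S : Finset (Fin (n + 1))) (hS : (S : Set (Fin (n + 1))) = Set.range fun a => e (Sum.inl a)) :
    {x : Fact p // x.Conn} × Fact q ≃ {z : Fact (n + 1) // z.orb = S} :=
  Equiv.ofBijective (fun w => ⟨glueFact e hl hr w.1.1 w.2, by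
      rw [← Finset.coe_inj, hS]
      exact (glued_glueFact hl hr w.1.1 w.2).coe_orb_eq hu w.1.2⟩) (by
    constructor
    · intro w w' h
      have h1 : glueFact e hl hr w.1.1 w.2 = glueFact e hl hr w'.1.1 w'.2 := congrArg Subtype.val h
      have h2 := glued_glueFact hl hr w.1.1 w.2
      rw [h1] at h2
      have h3 := h2.unique_left (glued_glueFact hl hr w'.1.1 w'.2)
      exact Prod.ext (Subtype.ext h3.1) h3.2
    · rintro ⟨z, hz⟩
      obtain ⟨x, y, h⟩ := exists_glued_of_inv hl hr z (by
        rw [← hS, ← hz]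
        exact z.inv_orb)
      have hx := h.conn_of_coe_orb_eq hu (by rw [hz, hS])
      exact ⟨(⟨x, hx⟩, y),
        Subtype.ext (Glued.unique_right hl hr (glued_glueFact hl hr x y) h)⟩)

variable {N : ℕ} (A B : Matrix (Fin N) (Fin N) ℂ)

theorem tsum_orb_eq (hN0 : N ≠ 0) (hn : n + 1 ≤ N) (S : Finset (Fin (n + 1))) :
    ∑' z : {z : Fact (n + 1) // z.orb = S}, z.1.weight A B =
      if 0 ∈ S then connSum S.card A B * factSum (n + 1 - S.card) A B else 0 := by
  split_ifs with h0
  · have hc : S.card ≤ n + 1 := (Finset.card_le_univ S).trans_eq (Fintype.card_fin _)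
    have hc' : Sᶜ.card = n + 1 - S.card := by rw [Finset.card_compl, Fintype.card_fin]
    let e := finSumEquivOfFinset (rfl : S.card = S.card) hc'
    have hl : StrictMono fun a => e (Sum.inl a) := by
      intro a b hab
      simpa [e] using hab
    have hr : StrictMono fun a => e (Sum.inr a) := by
      intro a b hab
      simpa [e] using hab
    have hS : (S : Set (Fin (n + 1))) = Set.range fun a => e (Sum.inl a) := by
      simp [e]
    obtain ⟨u₀, hu⟩ := hS.le (Finset.mem_coe.2 h0)
    have h1 : ∀ w, ((glueEquiv hl hr hu S hS) w).1.weight A B =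
        w.1.1.weight A B * w.2.weight A B :=
      fun w => (glued_glueFact hl hr w.1.1 w.2).weight_eq A B
    rw [← (glueEquiv hl hr hu S hS).tsum_eq]
    exact (tsum_congr h1).trans (tsum_mul_tsum_of_summable_norm
      ((summable_weight A B hN0 (hc.trans hn)).subtype _).norm
      (summable_weight A B hN0 ((Nat.sub_le _ _).trans hn)).norm).symm
  · have : IsEmpty {z : Fact (n + 1) // z.orb = S} :=
      ⟨fun z => h0 (z.2 ▸ z.1.zero_mem_orb)⟩
    exact tsum_empty

theorem factSum_succ (hN0 : N ≠ 0) (hn : n + 1 ≤ N) :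
    factSum (n + 1) A B =
      ∑ j ∈ Finset.range (n + 1), (n.choose j : ℂ) * (connSum (j + 1) A B * factSum (n - j) A B) := by
  have hs := summable_weight A B hN0 hn
  have hs' := (Equiv.summable_iff (Equiv.sigmaFiberEquiv (Fact.orb (n := n)))).2 hs
  have hz : (0 : Fin (n + 1)) ∉ Finset.univ.erase (0 : Fin (n + 1)) := Finset.notMem_erase _ _
  rw [factSum, ← (Equiv.sigmaFiberEquiv (Fact.orb (n := n))).tsum_eq]
  refine (hs'.tsum_sigma.trans (tsum_fintype _)).trans ?_
  refine (Finset.sum_congr rfl fun S _ => tsum_orb_eq A B hN0 hn S).trans ?_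
  rw [← Finset.powerset_univ, ← Finset.insert_erase (Finset.mem_univ (0 : Fin (n + 1))),
    Finset.sum_powerset_insert hz, Finset.sum_eq_zero, zero_add]
  · have h1 : ∀ t ∈ (Finset.univ.erase (0 : Fin (n + 1))).powerset,
        (if 0 ∈ insert 0 t then connSum (insert 0 t).card A B *
          factSum (n + 1 - (insert 0 t).card) A B else 0) =
        (fun j => connSum (j + 1) A B * factSum (n - j) A B) t.card := by
      intro t ht
      have : (0 : Fin (n + 1)) ∉ t := fun h => hz (Finset.mem_powerset.1 ht h)
      rw [if_pos (Finset.mem_insert_self _ _), Finset.card_insert_of_notMem this,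
        Nat.add_sub_add_right]
    rw [Finset.sum_congr rfl h1, Finset.sum_powerset_apply_card fun j =>
      connSum (j + 1) A B * factSum (n - j) A B]
    simp
  · intro t ht
    exact if_neg fun h => hz (Finset.mem_powerset.1 ht h)

end Splitting

section Cumulants

variable {N : ℕ} (μ : Measure (Matrix.unitaryGroup (Fin N) ℂ))
  (A B : Matrix (Fin N) (Fin N) ℂ)

theorem hciz_eq : hciz μ A B =
    fun z => ∫ U, Complex.exp (z * -((N : ℂ) * (A * conjBy B U).trace)) ∂μ := by
  funext z
  refine integral_congr_ae (Filter.Eventually.of_forall fun U => ?_)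
  simp only [conjBy, mul_assoc, mul_neg]

theorem continuous_neg_mul_trace : Continuous fun U : Matrix.unitaryGroup (Fin N) ℂ =>
    -((N : ℂ) * (A * conjBy B U).trace) := by
  have := continuous_conjBy B
  fun_prop

variable [IsProbabilityMeasure μ]

theorem hasDerivAt_integral_pow_mul_exp {f : Matrix.unitaryGroup (Fin N) ℂ → ℂ}
    (hf : Continuous f) (n : ℕ) (z : ℂ) :
    HasDerivAt (fun z => ∫ U, f U ^ n * Complex.exp (z * f U) ∂μ)
      (∫ U, f U ^ (n + 1) * Complex.exp (z * f U) ∂μ) z := by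
  obtain ⟨C, hC⟩ := isCompact_univ.exists_bound_of_continuousOn hf.continuousOn
  have hC' : ∀ U, ‖f U‖ ≤ C := fun U => hC U (Set.mem_univ U)
  have hC0 : 0 ≤ C := (norm_nonneg _).trans (hC' 1)
  have hcont : ∀ (k : ℕ) (w : ℂ), Continuous fun U => f U ^ k * Complex.exp (w * f U) :=
    fun k w => by fun_prop
  refine (hasDerivAt_integral_of_dominated_loc_of_deriv_le (Metric.ball_mem_nhds z one_pos)
    (F := fun z U => f U ^ n * Complex.exp (z * f U))
    (F' := fun z U => f U ^ (n + 1) * Complex.exp (z * f U))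
    (bound := fun _ => C ^ (n + 1) * Real.exp ((‖z‖ + 1) * C))
    (Filter.Eventually.of_forall fun w =>
      (integrable_of_continuous μ (hcont n w)).aestronglyMeasurable)
    (integrable_of_continuous μ (hcont n z))
    (integrable_of_continuous μ (hcont (n + 1) z)).aestronglyMeasurable ?_
    (integrable_const _) ?_).2
  · refine Filter.Eventually.of_forall fun U w hw => ?_
    have hw' : ‖w‖ ≤ ‖z‖ + 1 := by
      have := norm_le_norm_add_norm_sub' w z
      rw [Metric.mem_ball, dist_eq_norm] at hw
      linarith
    rw [norm_mul, norm_pow, Complex.norm_exp]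
    gcongr
    · exact hC' U
    · refine (Complex.re_le_norm _).trans ?_
      rw [norm_mul]
      gcongr
      exact hC' U
  · refine Filter.Eventually.of_forall fun U w _ => ?_
    have h := ((hasDerivAt_mul_const (x := w) (f U)).cexp).const_mul (f U ^ n)
    convert! h using 1
    ring

theorem iteratedDeriv_integral_exp {f : Matrix.unitaryGroup (Fin N) ℂ → ℂ}
    (hf : Continuous f) (n : ℕ) :
    iteratedDeriv n (fun z => ∫ U, Complex.exp (z * f U) ∂μ) =
      fun z => ∫ U, f U ^ n * Complex.exp (z * f U) ∂μ := by
  induction n with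
  | zero => simp
  | succ n ih =>
    rw [iteratedDeriv_succ, ih]
    exact funext fun z => (hasDerivAt_integral_pow_mul_exp μ hf n z).deriv

theorem iteratedDeriv_hciz [μ.IsMulLeftInvariant] (hN0 : N ≠ 0) {n : ℕ} (hn : n ≤ N) :
    iteratedDeriv n (hciz μ A B) 0 = (-1) ^ n * factSum n A B := by
  rw [hciz_eq, iteratedDeriv_integral_exp μ (continuous_neg_mul_trace A B),
    factSum_eq_integral A B μ hN0 hn, ← integral_const_mul, ← integral_const_mul]
  refine integral_congr_ae (Filter.Eventually.of_forall fun U => ?_)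
  simp only [zero_mul, Complex.exp_zero, mul_one]
  rw [neg_pow, mul_pow]

variable {μ A B}

/-- Leibniz recursion between moments and cumulants. -/
theorem iteratedDeriv_succ_of_exp_eq {K I : ℂ → ℂ} {ε : ℝ} (hε : 0 < ε)
    (hK : DifferentiableOn ℂ K (Metric.ball 0 ε))
    (hI : ∀ z ∈ Metric.ball (0 : ℂ) ε, Complex.exp (K z) = I z) (n : ℕ) :
    iteratedDeriv (n + 1) I 0 = ∑ j ∈ Finset.range (n + 1), (n.choose j : ℂ) *
      (iteratedDeriv (j + 1) K 0 * iteratedDeriv (n - j) I 0) := by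
  have hKa : AnalyticAt ℂ K 0 := hK.analyticAt (Metric.ball_mem_nhds 0 hε)
  have hev : (fun z => Complex.exp (K z)) =ᶠ[nhds 0] I := by
    filter_upwards [Metric.ball_mem_nhds 0 hε] with z hz using hI z hz
  have hIa : AnalyticAt ℂ I 0 := hKa.cexp.congr hev
  have hderiv : deriv I =ᶠ[nhds 0] deriv K * I := by
    filter_upwards [Metric.ball_mem_nhds 0 hε] with z hz
    have hz' : (fun z => Complex.exp (K z)) =ᶠ[nhds z] I := by
      filter_upwards [Metric.isOpen_ball.mem_nhds hz] with w hw using hI w hw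
    have h1 := (hK.differentiableAt (Metric.isOpen_ball.mem_nhds hz)).hasDerivAt.cexp
    rw [(h1.congr_of_eventuallyEq hz'.symm).deriv, hI z hz, Pi.mul_apply, mul_comm]
  rw [iteratedDeriv_succ', hderiv.iteratedDeriv_eq,
    iteratedDeriv_mul hKa.deriv.contDiffAt hIa.contDiffAt]
  refine Finset.sum_congr rfl fun j _ => ?_
  rw [iteratedDeriv_succ', mul_assoc]

theorem IsFreeEnergyBranch.iteratedDeriv_eq [μ.IsMulLeftInvariant] {ε : ℝ} (hε : 0 < ε)
    {F : ℂ → ℂ} (hF : IsFreeEnergyBranch μ A B ε F) (hN0 : N ≠ 0) {d : ℕ} (hd : 1 ≤ d)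
    (hdN : d ≤ N) : (N : ℂ) ^ 2 * iteratedDeriv d F 0 = (-1) ^ d * connSum d A B := by
  obtain ⟨hF1, hF2, hF3⟩ := hF
  rw [← iteratedDeriv_const_mul_field]
  have hrec := iteratedDeriv_succ_of_exp_eq hε (hF1.const_mul ((N : ℂ) ^ 2)) hF3
  have h0 : iteratedDeriv 0 (hciz μ A B) 0 = 1 := by
    rw [iteratedDeriv_zero, ← hF3 0 (Metric.mem_ball_self hε), hF2, mul_zero, Complex.exp_zero]
  have h0' : factSum 0 A B = 1 := by
    have := iteratedDeriv_hciz μ A B hN0 (Nat.zero_le N)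
    rw [h0] at this
    simpa using this.symm
  induction d using Nat.strong_induction_on with
  | _ d ih =>
    obtain ⟨n, rfl⟩ : ∃ n, d = n + 1 := ⟨d - 1, by omega⟩
    have h1 := hrec n
    rw [iteratedDeriv_hciz μ A B hN0 hdN, factSum_succ A B hN0 hdN, Finset.sum_range_succ,
      Finset.sum_range_succ, Nat.sub_self, h0, h0', mul_add, Finset.mul_sum] at h1
    have h2 : ∀ j ∈ Finset.range n,
        (-1 : ℂ) ^ (n + 1) * ((n.choose j : ℂ) * (connSum (j + 1) A B * factSum (n - j) A B)) =
        (n.choose j : ℂ) * (iteratedDeriv (j + 1) (fun z => (N : ℂ) ^ 2 * F z) 0 *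
          iteratedDeriv (n - j) (hciz μ A B) 0) := by
      intro j hj
      rw [Finset.mem_range] at hj
      rw [ih (j + 1) (by omega) (by omega) (by omega),
        iteratedDeriv_hciz μ A B hN0 (by omega : n - j ≤ N),
        show n + 1 = (j + 1) + (n - j) by omega, pow_add]
      ring
    rw [Finset.sum_congr rfl h2] at h1
    simpa using (add_left_cancel h1).symm

end Cumulants

section Genus

variable {d : ℕ}

theorem Fact.conn_iff (z : Fact d) {s : Set (Perm (Fin d))} (hs : ∀ g, g ∈ s ↔ g ∈ z.gens) :
    z.Conn ↔ GeneratesTransitively s := by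
  constructor
  · intro hz x
    have h := hz {y | ∃ g ∈ Subgroup.closure s, g x = y} ⟨x, 1, one_mem _, rfl⟩ (by
      intro h hh y
      have hh' := Subgroup.subset_closure ((hs h).2 hh)
      constructor
      · rintro ⟨g, hg, hgy⟩
        exact ⟨h⁻¹ * g, mul_mem (inv_mem hh') hg, by simp [hgy]⟩
      · rintro ⟨g, hg, rfl⟩
        exact ⟨h * g, mul_mem hh' hg, rfl⟩)
    exact fun y => h.ge (Set.mem_univ y)
  · rintro hs' T ⟨t, ht⟩ hT
    have key : ∀ g ∈ Subgroup.closure s, ∀ y, g y ∈ T ↔ y ∈ T := by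
      intro g hg
      induction hg using Subgroup.closure_induction with
      | mem g hg => exact hT g ((hs g).1 hg)
      | one => exact fun y => Iff.rfl
      | mul g h _ _ hg hh => exact fun y => (hg (h y)).trans (hh y)
      | inv g _ hg => exact fun y => by rw [← hg (g⁻¹ y)]; simp
    refine Set.eq_univ_of_forall fun y => ?_
    obtain ⟨g, hg, rfl⟩ := hs' t y
    exact (key g hg t).2 ht

theorem isMonotoneList_ofFn {r : ℕ} (τ : Fin r → Perm (Fin d)) :
    IsMonotoneList (List.ofFn τ) ↔ IsMonotoneTuple τ := by
  rw [IsMonotoneList, IsMonotoneTuple, List.forall_mem_ofFn_iff, List.pairwise_ofFn,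
    monotone_iff_forall_lt]

/-- The factorizations counted by `Hr d α β r`. -/
abbrev TypedFact (d : ℕ) (α β : d.Partition) (r : ℕ) : Type :=
  {T : Perm (Fin d) × Perm (Fin d) × (Fin r → Perm (Fin d)) //
    HasCycleType T.1 α ∧ HasCycleType T.2.1 β ∧ IsMonotoneTuple T.2.2 ∧
    T.1 * T.2.1 * (List.ofFn T.2.2).prod = 1 ∧
    GeneratesTransitively ({T.1, T.2.1} ∪ Set.range T.2.2)}

/-- A counted tuple, as a transitive factorization. -/
def TypedFact.toFact {α β : d.Partition} {r : ℕ} (T : TypedFact d α β r) :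
    {z : Fact d // z.Conn} :=
  ⟨⟨(T.1.1, T.1.2.1, List.ofFn T.1.2.2), (isMonotoneList_ofFn _).2 T.2.2.2.1, T.2.2.2.2.1⟩,
    (Fact.conn_iff _ (by simp [Fact.gens, or_assoc])).2 T.2.2.2.2.2⟩

theorem exists_hasCycleType (π : Perm (Fin d)) : ∃ α : d.Partition, HasCycleType π α :=
  ⟨⟨π.partition.parts, π.partition.parts_pos, by
    rw [π.partition.parts_sum, Fintype.card_fin]⟩, rfl⟩

theorem HasCycleType.unique {π : Perm (Fin d)} {α β : d.Partition} (h : HasCycleType π α)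
    (h' : HasCycleType π β) : α = β :=
  Nat.Partition.ext (h.symm.trans h')

theorem HasCycleType.cycleCount_eq {π : Perm (Fin d)} {α : d.Partition} (h : HasCycleType π α) :
    cycleCount π = α.parts.card :=
  congrArg Multiset.card h

theorem exists_ofFn_eq {γ : Type*} (l : List γ) {r : ℕ} (h : l.length = r) :
    ∃ f : Fin r → γ, List.ofFn f = l := by
  subst h
  exact ⟨l.get, List.ofFn_get l⟩

/-- Transitive factorizations are classified by their genus and their cycle types. -/
noncomputable def genusEquiv (hd : 1 ≤ d) :
    (Σ g : ℕ, Σ ab : d.Partition × d.Partition,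
      TypedFact d ab.1 ab.2 (2 * g + ab.1.parts.card + ab.2.parts.card - 2)) ≃
      {z : Fact d // z.Conn} :=
  Equiv.ofBijective (fun w => w.2.2.toFact) (by
    constructor
    · rintro ⟨g, ⟨α, β⟩, ⟨⟨ρ, σ, τ⟩, h1, h2, h3⟩⟩ ⟨g', ⟨α', β'⟩, ⟨⟨ρ', σ', τ'⟩, h1', h2', h3'⟩⟩ h
      dsimp only at h1 h2 h1' h2' h3 h3'
      have h4 : (ρ, σ, List.ofFn τ) = (ρ', σ', List.ofFn τ') :=
        congrArg (fun z : {z : Fact d // z.Conn} => z.1.1) h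
      rw [Prod.mk.injEq, Prod.mk.injEq] at h4
      obtain ⟨rfl, rfl, h5⟩ := h4
      obtain rfl := h1.unique h1'
      obtain rfl := h2.unique h2'
      have h6 := congrArg List.length h5
      rw [List.length_ofFn, List.length_ofFn, ← h1.cycleCount_eq, ← h2.cycleCount_eq] at h6
      have := cycleCount_pos hd ρ
      have := cycleCount_pos hd σ
      obtain rfl : g = g' := by omega
      obtain rfl := List.ofFn_injective h5
      rfl
    · rintro ⟨⟨⟨ρ, σ, l⟩, h1, h2⟩, h3⟩
      obtain ⟨α, hα⟩ := exists_hasCycleType ρ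
      obtain ⟨β, hβ⟩ := exists_hasCycleType σ
      obtain ⟨g, hg⟩ := Fact.exists_genus hd _ h3
      dsimp only at hg h1 h2
      rw [hα.cycleCount_eq, hβ.cycleCount_eq] at hg
      obtain ⟨τ, rfl⟩ := exists_ofFn_eq l hg
      exact ⟨⟨g, (α, β), ⟨(ρ, σ, τ), hα, hβ, (isMonotoneList_ofFn _).1 h1, h2,
        (Fact.conn_iff _ (by simp [Fact.gens, or_assoc])).1 h3⟩⟩, rfl⟩)

variable {N : ℕ} (A B : Matrix (Fin N) (Fin N) ℂ)

theorem TypedFact.weight_toFact {α β : d.Partition} {r : ℕ} (T : TypedFact d α β r) :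
    T.toFact.1.weight A B = (-(N : ℂ)⁻¹) ^ r * (pPoly A α * pPoly B β) := by
  rw [Fact.weight, ← cycleTrace_eq_pPoly A _ α T.2.1, ← cycleTrace_eq_pPoly B _ β T.2.2.1]
  simp only [toFact, List.length_ofFn]

theorem hasSum_typedFact (g : ℕ) :
    HasSum (fun w : Σ ab : d.Partition × d.Partition,
      TypedFact d ab.1 ab.2 (2 * g + ab.1.parts.card + ab.2.parts.card - 2) =>
        w.2.toFact.1.weight A B)
      (∑ ab : d.Partition × d.Partition, (Hg d g ab.1 ab.2 : ℂ) *
        ((-(N : ℂ)⁻¹) ^ (2 * g + ab.1.parts.card + ab.2.parts.card - 2) *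
          (pPoly A ab.1 * pPoly B ab.2))) := by
  have inst : ∀ ab : d.Partition × d.Partition, Fintype
      (TypedFact d ab.1 ab.2 (2 * g + ab.1.parts.card + ab.2.parts.card - 2)) :=
    fun ab => Fintype.ofFinite _
  have h := hasSum_fintype (fun w : Σ ab : d.Partition × d.Partition,
    TypedFact d ab.1 ab.2 (2 * g + ab.1.parts.card + ab.2.parts.card - 2) =>
      w.2.toFact.1.weight A B)
  rw [Fintype.sum_sigma] at h
  convert! h using 2 with ab
  symm
  refine (Finset.sum_congr rfl fun T _ => T.weight_toFact A B).trans ?_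
  rw [Finset.sum_const, Finset.card_univ, nsmul_eq_mul, ← Nat.card_eq_fintype_card]
  rfl

theorem hasSum_genus (hN0 : N ≠ 0) (hd : 1 ≤ d) (hdN : d ≤ N) :
    HasSum (fun g => ∑ ab : d.Partition × d.Partition, (Hg d g ab.1 ab.2 : ℂ) *
      ((-(N : ℂ)⁻¹) ^ (2 * g + ab.1.parts.card + ab.2.parts.card - 2) *
        (pPoly A ab.1 * pPoly B ab.2))) (connSum d A B) := by
  have h1 : HasSum (fun z : {z : Fact d // z.Conn} => z.1.weight A B) (connSum d A B) :=
    ((summable_weight A B hN0 hdN).subtype _).hasSum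
  have h2 := (genusEquiv hd).hasSum_iff.2 h1
  refine HasSum.sigma h2 fun g => ?_
  exact hasSum_typedFact A B g

theorem card_parts_pos (hd : 1 ≤ d) (α : d.Partition) : 1 ≤ α.parts.card := by
  rw [Nat.one_le_iff_ne_zero, Ne, Multiset.card_eq_zero]
  intro h
  have := α.parts_sum
  rw [h, Multiset.sum_zero] at this
  omega

theorem Cmat_div (hN0 : N ≠ 0) (hd : 1 ≤ d) (g : ℕ) :
    Cmat g d A B / (N : ℂ) ^ (2 * g) = (-1) ^ d * ((N : ℂ) ^ 2)⁻¹ *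
      ∑ ab : d.Partition × d.Partition, (Hg d g ab.1 ab.2 : ℂ) *
      ((-(N : ℂ)⁻¹) ^ (2 * g + ab.1.parts.card + ab.2.parts.card - 2) *
        (pPoly A ab.1 * pPoly B ab.2)) := by
  have hN : (N : ℂ) ≠ 0 := Nat.cast_ne_zero.2 hN0
  rw [Cmat, Fintype.sum_prod_type, Finset.sum_div, Finset.mul_sum]
  refine Finset.sum_congr rfl fun α _ => ?_
  rw [Finset.sum_div, Finset.mul_sum]
  refine Finset.sum_congr rfl fun β _ => ?_
  dsimp only
  obtain ⟨a, ha⟩ := Nat.exists_eq_add_of_le (card_parts_pos hd α)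
  obtain ⟨b, hb⟩ := Nat.exists_eq_add_of_le (card_parts_pos hd β)
  rw [ha, hb, show 2 * g + (1 + a) + (1 + b) - 2 = 2 * g + a + b by omega, neg_pow (N : ℂ)⁻¹,
    inv_pow]
  field_simp
  simp only [pow_add, pow_mul, neg_one_sq, one_pow]
  ring

end Genus

end Factorizations

/-- **Leading Derivatives Theorem.** For `1 ≤ d ≤ N` the series
`∑_g C_{g,d}(A,B)/N^{2g}` converges absolutely with sum `F^{(d)}(0)`. -/
theorem leading_derivatives (N : ℕ) (hN : 1 ≤ N)
    (μ : Measure (Matrix.unitaryGroup (Fin N) ℂ))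
    (hμ : μ.IsHaarMeasure) (hμprob : IsProbabilityMeasure μ)
    (A B : Matrix (Fin N) (Fin N) ℂ)
    (hA : IsStarNormal A) (hB : IsStarNormal B)
    (ε : ℝ) (hε : 0 < ε) (F : ℂ → ℂ)
    (hF : IsFreeEnergyBranch μ A B ε F)
    (d : ℕ) (hd1 : 1 ≤ d) (hdN : d ≤ N) :
    Summable (fun g : ℕ => ‖Cmat g d A B / (N : ℂ) ^ (2 * g)‖) ∧
    HasSum (fun g : ℕ => Cmat g d A B / (N : ℂ) ^ (2 * g)) (iteratedDeriv d F 0) := by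
  have hN0 : N ≠ 0 := Nat.one_le_iff_ne_zero.1 hN
  have hN2 : ((N : ℂ) ^ 2) ≠ 0 := pow_ne_zero 2 (Nat.cast_ne_zero.2 hN0)
  have hsum : HasSum (fun g : ℕ => Cmat g d A B / (N : ℂ) ^ (2 * g)) (iteratedDeriv d F 0) := by
    have h := (hasSum_genus A B hN0 hd1 hdN).mul_left ((-1) ^ d * ((N : ℂ) ^ 2)⁻¹)
    have hval : iteratedDeriv d F 0 = (-1) ^ d * ((N : ℂ) ^ 2)⁻¹ * connSum d A B := by
      rw [mul_right_comm, ← hF.iteratedDeriv_eq hε hN0 hd1 hdN, mul_comm, inv_mul_cancel_left₀ hN2]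
    rw [hval]
    simpa only [← Cmat_div A B hN0 hd1] using h
  exact ⟨hsum.summable.norm, hsum⟩

end HCIZ
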